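/- arXiv:0809.1952 — 2 statements merged into one kernel-verified Lean document; each statement's English description precedes it below -/
import Mathlib

section
/- Let G be a Schwartz K'-invariant function on ℝ³×ℝ. Then there exists a Schwartz SO(3)-invariant function F on ℝ³×ℝ³ with ∫_{ℝ²} F(x,(y₁,y₂,t)) dy₁dy₂ = G(x,t) for all (x,t), if and only if for each j∈ℕ there exist Schwartz functions a_{j,0},…,a_{j,j} ∈ 𝒮(ℝ) such that for all x∈ℝ³: ∫_ℝ G(x,t)·t^j dt = Σ_{i=0}^{j} a_{j,i}(|x|²)·x₃^i. -/
open MeasureTheory Complex Matrix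

noncomputable section

abbrev V3 := Fin 3 → ℝ
abbrev Mat3 := Matrix (Fin 3) (Fin 3) ℝ

instance : MeasurableSpace Mat3 := (inferInstance : MeasurableSpace (Fin 3 → Fin 3 → ℝ))

/-- The set of special orthogonal 3×3 real matrices. -/
def SO3 : Set Mat3 := {A | A * A.transpose = 1 ∧ A.det = 1}

/-- `SO(3)`-invariance of a function on `ℝ³ × ℝ³` (simultaneous action on both factors). -/
def Inv3 (F : V3 × V3 → ℂ) : Prop :=
  ∀ k ∈ SO3, ∀ x y : V3, F (k.mulVec x, k.mulVec y) = F (x, y)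

/-- The orthogonal group `O(2)` as a set of 2×2 matrices. -/
def O2 : Set (Matrix (Fin 2) (Fin 2) ℝ) := {A | A * A.transpose = 1}

/-- The action of `A ∈ O(2)` on `ℝ³ × ℝ`:
`A·(x₁,x₂,x₃,t) = (A(x₁,x₂), (det A)x₃, (det A)t)`. -/
def KAct (A : Matrix (Fin 2) (Fin 2) ℝ) (p : (Fin 3 → ℝ) × ℝ) : (Fin 3 → ℝ) × ℝ :=
  (![A.mulVec ![p.1 0, p.1 1] 0, A.mulVec ![p.1 0, p.1 1] 1, A.det * p.1 2], A.det * p.2)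

/-- `K'`-invariance of a function on `ℝ³ × ℝ`. -/
def InvK' (G : (Fin 3 → ℝ) × ℝ → ℂ) : Prop := ∀ A ∈ O2, ∀ p, G (KAct A p) = G p

/-- The Radon-type map: `RF(x,t) = ∫_{ℝ²} F(x, (y₁, y₂, t)) dy₁ dy₂`. -/
def RadonT (F : (Fin 3 → ℝ) × (Fin 3 → ℝ) → ℂ) (x : Fin 3 → ℝ) (t : ℝ) : ℂ :=
  ∫ w : ℝ × ℝ, F (x, ![w.1, w.2, t])

section PartA
open scoped ContDiff

lemma param_smooth_nat (μ : Measure ℝ) (n : ℕ) : ∀ (f : ℝ → ℂ) (_ : ContDiff ℝ ∞ f)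
    (_ : ∀ n : ℕ, ∃ C, ∀ x, ‖iteratedDeriv n f x‖ ≤ C) (q : ℝ → ℝ) (_ : Continuous q)
    (w : ℝ → ℂ) (_ : AEStronglyMeasurable w μ)
    (_ : ∀ k : ℕ, Integrable (fun l => |q l| ^ k * ‖w l‖) μ),
    ContDiff ℝ n (fun u : ℝ => ∫ l, w l * f (q l * u) ∂μ) := by
  induction n with
  | zero =>
    intro f hf hb q hq w hw hi
    refine contDiff_zero.2 ?_
    obtain ⟨C, hC⟩ := hb 0
    refine continuous_of_dominated (bound := fun l => C * (|q l| ^ 0 * ‖w l‖)) ?_ ?_ ?_ ?_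
    · intro u
      exact hw.mul (hf.continuous.comp (by fun_prop)).aestronglyMeasurable
    · intro u
      filter_upwards with l
      have := hC (q l * u)
      rw [iteratedDeriv_zero] at this
      rw [norm_mul, pow_zero, one_mul, mul_comm]
      gcongr
    · exact (hi 0).const_mul C
    · filter_upwards with l
      exact continuous_const.mul (hf.continuous.comp (by fun_prop))
  | succ n ih =>
    intro f hf hb q hq w hw hi
    have hd : ∀ u, HasDerivAt (fun u : ℝ => ∫ l, w l * f (q l * u) ∂μ)
        (∫ l, (w l * (q l : ℂ)) * deriv f (q l * u) ∂μ) u := by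
      intro u
      obtain ⟨C, hC⟩ := hb 1
      obtain ⟨C0, hC0⟩ := hb 0
      simp only [iteratedDeriv_one, iteratedDeriv_zero] at hC hC0
      have hm : ∀ u, AEStronglyMeasurable (fun l => w l * f (q l * u)) μ := fun u =>
        hw.mul (hf.continuous.comp (by fun_prop)).aestronglyMeasurable
      refine (hasDerivAt_integral_of_dominated_loc_of_deriv_le (𝕜 := ℝ) (s := Set.univ)
        (F := fun u l => w l * f (q l * u)) (F' := fun u l => (w l * (q l : ℂ)) * deriv f (q l * u))
        (bound := fun l => C * (|q l| ^ 1 * ‖w l‖)) Filter.univ_mem ?_ ?_ ?_ ?_ ?_ ?_).2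
      · filter_upwards with u using hm u
      · refine ((hi 0).const_mul C0).mono' (hm u) ?_
        filter_upwards with l
        rw [norm_mul, pow_zero, one_mul, mul_comm]
        gcongr
        exact hC0 _
      · have : Continuous (deriv f) := hf.continuous_deriv (by simp)
        exact (hw.mul (by fun_prop)).mul (this.comp (by fun_prop)).aestronglyMeasurable
      · filter_upwards with l u _
        rw [norm_mul, norm_mul, pow_one, mul_comm, mul_comm ‖w l‖, Complex.norm_real, Real.norm_eq_abs]
        gcongr
        exact hC _
      · exact (hi 1).const_mul C
      · filter_upwards with l u _
        have h1 : HasDerivAt f (deriv f (q l * u)) (q l * u) :=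
          (hf.differentiable (by simp) _).hasDerivAt
        have h2 : HasDerivAt (fun u : ℝ => q l * u) (q l) u := by
          simpa using (hasDerivAt_id u).const_mul (q l)
        have := (h1.scomp u h2).const_mul (w l)
        refine HasDerivAt.congr_deriv (f := fun u => w l * f (q l * u)) this ?_
        simp [mul_assoc]
    have : ((n + 1 : ℕ) : WithTop ℕ∞) = (n : WithTop ℕ∞) + 1 := by push_cast; rfl
    rw [this, contDiff_succ_iff_deriv]
    refine ⟨fun u => (hd u).differentiableAt, by simp, ?_⟩
    have : deriv (fun u : ℝ => ∫ l, w l * f (q l * u) ∂μ) = fun u =>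
        (∫ l, (w l * (q l : ℂ)) * deriv f (q l * u) ∂μ) := funext fun u => (hd u).deriv
    rw [this]
    refine ih (deriv f) (contDiff_infty_iff_deriv.1 hf).2 ?_ q hq _ (hw.mul (by fun_prop)) ?_
    · intro n
      obtain ⟨C, hC⟩ := hb (n+1)
      exact ⟨C, fun x => by rw [← iteratedDeriv_succ']; exact hC x⟩
    · intro k
      refine (hi (k+1)).congr ?_
      filter_upwards with l
      simp [pow_succ]; ring

lemma param_smooth (μ : Measure ℝ) (f : ℝ → ℂ) (hf : ContDiff ℝ ∞ f)
    (hb : ∀ n : ℕ, ∃ C, ∀ x, ‖iteratedDeriv n f x‖ ≤ C) (q : ℝ → ℝ) (hq : Continuous q)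
    (w : ℝ → ℂ) (hw : AEStronglyMeasurable w μ)
    (hi : ∀ k : ℕ, Integrable (fun l => |q l| ^ k * ‖w l‖) μ) :
    ContDiff ℝ ∞ (fun u : ℝ => ∫ l, w l * f (q l * u) ∂μ) :=
  contDiff_infty.2 fun n => param_smooth_nat μ n f hf hb q hq w hw hi

/-- smooth with bounds `|r|^k |f^(n)| ≤ C` for `k ∈ K`. -/
def Bd (K : Set ℕ) (f : ℝ → ℂ) : Prop :=
  ContDiff ℝ ∞ f ∧ ∀ k ∈ K, ∀ n : ℕ, ∃ C, ∀ r : ℝ, |r| ^ k * ‖iteratedDeriv n f r‖ ≤ C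

lemma Bd.deriv {K : Set ℕ} {f : ℝ → ℂ} (h : Bd K f) : Bd K (deriv f) := by
  refine ⟨(contDiff_infty_iff_deriv.1 h.1).2, fun k hk n => ?_⟩
  obtain ⟨C, hC⟩ := h.2 k hk (n+1)
  exact ⟨C, fun r => by rw [← iteratedDeriv_succ']; exact hC r⟩

lemma Bd.const_mul {K : Set ℕ} {f : ℝ → ℂ} (h : Bd K f) (c : ℂ) : Bd K (fun r => c * f r) := by
  refine ⟨contDiff_const.mul h.1, fun k hk n => ?_⟩
  obtain ⟨C, hC⟩ := h.2 k hk n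
  refine ⟨‖c‖ * C, fun r => ?_⟩
  rw [iteratedDeriv_const_mul_field, norm_mul, mul_left_comm]
  exact mul_le_mul_of_nonneg_left (hC r) (norm_nonneg _)

lemma iteratedDeriv_id_mul (c : ℝ → ℂ) (hc : ContDiff ℝ ∞ c) (n : ℕ) :
    ∀ r : ℝ, iteratedDeriv (n + 1) (fun r : ℝ => (r : ℂ) * c r) r
      = r * iteratedDeriv (n + 1) c r + (n + 1) * iteratedDeriv n c r := by
  induction n with
  | zero =>
    intro r
    simp only [zero_add, iteratedDeriv_one, iteratedDeriv_zero]
    have h1 : HasDerivAt (fun r : ℝ => (r : ℂ)) 1 r := by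
      simpa using (hasDerivAt_id r).ofReal_comp
    have h2 : HasDerivAt c (deriv c r) r := (hc.differentiable (by simp) _).hasDerivAt
    rw [(h1.fun_mul h2).deriv]; simp; ring
  | succ n ih =>
    intro r
    rw [iteratedDeriv_succ, funext ih]
    have h1 : HasDerivAt (fun r : ℝ => (r : ℂ)) 1 r := by
      simpa using (hasDerivAt_id r).ofReal_comp
    have hd : ∀ m : ℕ, HasDerivAt (iteratedDeriv m c) (iteratedDeriv (m+1) c r) r := by
      intro m
      rw [iteratedDeriv_succ]
      exact ((hc.differentiable_iteratedDeriv m (by exact_mod_cast WithTop.coe_lt_top _)) r).hasDerivAt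
    rw [((h1.fun_mul (hd (n+1))).fun_add ((hd n).const_mul _)).deriv]
    push_cast; ring

lemma hadamard {K : Set ℕ} (h0 : 0 ∈ K) {b : ℝ → ℂ} (hb : Bd K b) (hb0 : b 0 = 0) :
    ∃ c, Bd K c ∧ ∀ r : ℝ, b r = r * c r := by
  have hbd := hb.deriv
  let c : ℝ → ℂ := fun u => ∫ l in (Set.Icc (0:ℝ) 1), 1 * deriv b (id l * u)
  have hc : ContDiff ℝ ∞ c := by
    refine param_smooth _ _ hbd.1 (fun n => ?_) id continuous_id _ (by fun_prop) ?_
    · obtain ⟨C, hC⟩ := hbd.2 0 h0 n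
      exact ⟨C, fun x => by simpa using hC x⟩
    · intro k
      have : ContinuousOn (fun l : ℝ => |id l| ^ k * ‖(1:ℂ)‖) (Set.Icc 0 1) := by fun_prop
      exact this.integrableOn_Icc
  have hbc : ∀ r : ℝ, b r = r * c r := by
    intro r
    have hbcont : Continuous (deriv b) := hb.1.continuous_deriv (by simp)
    have h1 : ∫ l in (0:ℝ)..1, (r:ℂ) * deriv b (l * r) = b (1 * r) - b (0 * r) := by
      refine intervalIntegral.integral_eq_sub_of_hasDerivAt (f := fun l => b (l * r)) ?_ ?_
      · intro l _
        have h1 : HasDerivAt b (deriv b (l * r)) (l * r) :=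
          (hb.1.differentiable (by simp) _).hasDerivAt
        have h2 : HasDerivAt (fun l : ℝ => l * r) r l := by
          simpa using (hasDerivAt_id l).mul_const r
        simpa [Function.comp_def] using h1.scomp l h2
      · exact (by fun_prop : Continuous fun l : ℝ => (r:ℂ) * deriv b (l * r)).intervalIntegrable _ _
    rw [intervalIntegral.integral_const_mul] at h1
    simp only [one_mul, zero_mul, hb0, sub_zero] at h1
    rw [← h1, intervalIntegral.integral_of_le zero_le_one, ← integral_Icc_eq_integral_Ioc]
    simp [c]
  refine ⟨c, ⟨hc, fun k hk n => ?_⟩, hbc⟩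
  have hcont : ∀ n, Continuous (iteratedDeriv n c) := fun n =>
    hc.continuous_iteratedDeriv n (by exact_mod_cast le_top)
  have key : ∃ C, ∀ r : ℝ, 1 ≤ |r| → |r| ^ k * ‖iteratedDeriv n c r‖ ≤ C := by
    induction n with
    | zero =>
      obtain ⟨C, hC⟩ := hb.2 k hk 0
      refine ⟨C, fun r hr => le_trans ?_ (hC r)⟩
      simp only [iteratedDeriv_zero]
      rw [hbc r, norm_mul, Complex.norm_real, Real.norm_eq_abs]
      gcongr
      exact le_mul_of_one_le_left (norm_nonneg _) hr
    | succ n ih =>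
      obtain ⟨C, hC⟩ := hb.2 k hk (n+1)
      obtain ⟨D, hD⟩ := ih
      refine ⟨C + (n+1) * D, fun r hr => ?_⟩
      have e := iteratedDeriv_id_mul c hc n r
      rw [← funext hbc] at e
      have e2 : (r:ℂ) * iteratedDeriv (n + 1) c r
        = iteratedDeriv (n + 1) b r - (n + 1) * iteratedDeriv n c r := by rw [e]; ring
      have e3 : |r| * ‖iteratedDeriv (n + 1) c r‖ ≤
        ‖iteratedDeriv (n + 1) b r‖ + (n+1) * ‖iteratedDeriv n c r‖ := by
        rw [← Real.norm_eq_abs, ← Complex.norm_real, ← norm_mul, e2]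
        refine (norm_sub_le _ _).trans ?_
        rw [norm_mul]
        gcongr
        exact_mod_cast (Complex.norm_natCast (n+1)).le
      have e4 : ‖iteratedDeriv (n + 1) c r‖ ≤ |r| * ‖iteratedDeriv (n + 1) c r‖ :=
        le_mul_of_one_le_left (norm_nonneg _) hr
      calc _ ≤ |r|^k * (‖iteratedDeriv (n + 1) b r‖ + (n+1) * ‖iteratedDeriv n c r‖) := by
            gcongr; exact e4.trans e3
        _ = |r|^k * ‖iteratedDeriv (n + 1) b r‖ + (n+1) * (|r|^k * ‖iteratedDeriv n c r‖) := by ring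
        _ ≤ _ := by gcongr; exacts [hC r, hD r hr]
  obtain ⟨C, hC⟩ := key
  obtain ⟨D, hD⟩ := (isCompact_Icc (a := (-1:ℝ)) (b := 1)).exists_bound_of_continuousOn
    (f := fun r : ℝ => |r| ^ k * ‖iteratedDeriv n c r‖)
    ((by have := hcont n; fun_prop : Continuous _).continuousOn)
  refine ⟨max C D, fun r => ?_⟩
  rcases le_or_gt 1 |r| with h | h
  · exact (hC r h).trans (le_max_left _ _)
  · exact (le_abs_self _).trans ((hD r (abs_le.1 h.le)).trans (le_max_right _ _))

lemma sq_rec {K : Set ℕ} (h0 : 0 ∈ K) (n : ℕ) : ∀ (a b : ℝ → ℂ) (_ : ContDiff ℝ ∞ a)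
    (_ : Bd K b) (_ : ∀ r : ℝ, a (r^2) = b r),
    ∃ b', Bd K b' ∧ ∀ r : ℝ, iteratedDeriv n a (r^2) = b' r := by
  induction n with
  | zero => intro a b ha hb h; exact ⟨b, hb, by simpa using h⟩
  | succ n ih =>
    intro a b ha hb h
    have hd : ∀ r : ℝ, deriv b r = r * (2 * deriv a (r^2)) := by
      intro r
      have h1 : HasDerivAt a (deriv a (r^2)) (r^2) := (ha.differentiable (by simp) _).hasDerivAt
      have h2 : HasDerivAt (fun r : ℝ => r^2) (2 * r) r := by simpa using hasDerivAt_pow 2 r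
      have h3 := HasDerivAt.scomp (h := fun r : ℝ => r^2) r h1 h2
      have : (a ∘ fun r : ℝ => r^2) = b := funext h
      rw [this] at h3
      rw [h3.deriv]; simp; ring
    obtain ⟨c, hc, hbc⟩ := hadamard h0 hb.deriv (by rw [hd 0]; simp)
    have hdc : Continuous (deriv a) := ha.continuous_deriv (by simp)
    have : (fun r : ℝ => deriv a (r^2)) = fun r => (1/2) * c r := by
      refine Continuous.ext_on (dense_compl_singleton (0:ℝ)) (by fun_prop)
        (continuous_const.mul hc.1.continuous) ?_
      intro r hr
      have hr' : (r:ℂ) ≠ 0 := by simpa using hr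
      have := (hd r).symm.trans (hbc r)
      have := mul_left_cancel₀ hr' this
      simp only [← this]; ring
    obtain ⟨b', h1, h2⟩ := ih (deriv a) _ (contDiff_infty_iff_deriv.1 ha).2 (hc.const_mul (1/2))
      (fun r => congrFun this r)
    exact ⟨b', h1, fun r => by rw [iteratedDeriv_succ']; exact h2 r⟩
end PartA

section PartB
open scoped ContDiff FourierTransform

lemma ext_bound {K : Set ℕ} (h0 : 0 ∈ K) {a b : ℝ → ℂ} (ha : ContDiff ℝ ∞ a) (hb : Bd K b)
    (hab : ∀ r : ℝ, a (r^2) = b r) (hz : ∀ u ≤ (-1:ℝ), a u = 0) (k n : ℕ) (hk : 2 * k ∈ K) :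
    ∃ C, ∀ u : ℝ, |u| ^ k * ‖iteratedDeriv n a u‖ ≤ C := by
  obtain ⟨b', hb', h⟩ := sq_rec h0 n a b ha hb hab
  obtain ⟨C, hC⟩ := hb'.2 _ hk 0
  have hcont : Continuous (iteratedDeriv n a) :=
    ha.continuous_iteratedDeriv n (by exact_mod_cast le_top)
  obtain ⟨D, hD⟩ := (isCompact_Icc (a := (-1:ℝ)) (b := 0)).exists_bound_of_continuousOn
    (f := fun r : ℝ => |r| ^ k * ‖iteratedDeriv n a r‖)
    ((by fun_prop : Continuous _).continuousOn)
  refine ⟨max C (max D 0), fun u => ?_⟩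
  rcases le_or_gt 0 u with hu | hu
  · refine le_trans ?_ (le_max_left _ _)
    have := hC (√u)
    rw [iteratedDeriv_zero, ← h, Real.sq_sqrt hu, abs_of_nonneg (Real.sqrt_nonneg _), pow_mul,
      Real.sq_sqrt hu] at this
    rwa [abs_of_nonneg hu]
  rcases le_or_gt (-1) u with hu' | hu'
  · exact (le_abs_self _).trans ((hD u ⟨hu', hu.le⟩).trans
      ((le_max_left _ _).trans (le_max_right _ _)))
  · have : iteratedDeriv n a u = 0 := by
      have e : a =ᶠ[nhds u] fun _ => 0 := by
        filter_upwards [Iio_mem_nhds hu'] with v hv using hz v (le_of_lt hv)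
      rw [e.iteratedDeriv_eq]
      simp
    rw [this]; simp

lemma exists_entire_cos : ∃ g : ℝ → ℂ, ContDiff ℝ ∞ g ∧ ∀ r : ℝ, g (r^2) = Complex.cos r := by
  let c : ℕ → ℝ := fun n => (-1)^n / (2*n).factorial
  let p := FormalMultilinearSeries.ofScalars ℝ c
  have hr : p.radius = ⊤ := by
    refine FormalMultilinearSeries.ofScalars_radius_eq_top_of_tendsto ℝ c ?_ ?_
    · filter_upwards with n
      simp [c]; positivity
    · have : (fun n : ℕ => ‖c n.succ‖ / ‖c n‖) = fun n : ℕ => (1:ℝ) / ((2*n+2)*(2*n+1)) := by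
        funext n
        simp only [c, norm_div, norm_pow, norm_neg, norm_one, one_pow, Nat.succ_eq_add_one]
        rw [show 2 * (n+1) = (2*n+1)+1 by ring, Nat.factorial_succ, Nat.factorial_succ]
        have : ((2*n).factorial : ℝ) ≠ 0 := by positivity
        simp only [Nat.cast_mul, norm_mul, Real.norm_natCast]
        push_cast
        field_simp
        ring
      rw [this]
      refine squeeze_zero (fun n => by positivity) (fun n => ?_) tendsto_one_div_add_atTop_nhds_zero_nat
      gcongr
      nlinarith [(Nat.cast_nonneg n : (0:ℝ) ≤ n)]
  have hps := p.hasFPowerSeriesOnBall (by rw [hr]; simp)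
  have han : AnalyticOnNhd ℝ p.sum Set.univ := by
    have := hps.analyticOnNhd
    rw [hr] at this
    simpa using this
  refine ⟨fun z => (p.sum z : ℂ), ?_, fun r => ?_⟩
  · have := han.contDiff (n := ∞)
    exact Complex.ofRealCLM.contDiff.comp this
  · have h1 : p.sum (r^2) = Real.cos r := by
      have : p.sum = FormalMultilinearSeries.ofScalarsSum c := rfl
      rw [this, FormalMultilinearSeries.ofScalarsSum_eq_tsum]
      refine (HasSum.tsum_eq ?_)
      refine (Real.hasSum_cos r).congr_fun ?_
      intro n
      simp [c, ← pow_mul]; ring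
    simp [h1]

lemma Bd_cos : Bd {0} (fun r : ℝ => Complex.cos r) := by
  have h : ∀ n : ℕ, ∀ r : ℝ, iteratedDeriv n (fun r : ℝ => Complex.cos r) r
      = ((iteratedDeriv n Real.cos r : ℝ) : ℂ) := by
    intro n
    induction n with
    | zero => intro r; simp
    | succ n ih =>
      intro r
      rw [iteratedDeriv_succ, funext ih, iteratedDeriv_succ]
      have hd : Differentiable ℝ (iteratedDeriv n Real.cos) :=
        (Real.contDiff_cos (n := ∞)).differentiable_iteratedDeriv n (by exact_mod_cast WithTop.coe_lt_top _)
      exact ((hd r).hasDerivAt.ofReal_comp).deriv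
  refine ⟨?_, fun k hk n => ⟨1, fun r => ?_⟩⟩
  · exact (Complex.contDiff_cos.restrict_scalars ℝ).comp Complex.ofRealCLM.contDiff
  · simp only [Set.mem_singleton_iff] at hk
    subst hk
    rw [h, Complex.norm_real, pow_zero, one_mul, Real.norm_eq_abs]
    exact Real.abs_iteratedDeriv_cos_le_one n r

def kap (u : ℝ) : ℂ := (Real.smoothTransition (u + 1) : ℂ)
lemma kap_smooth : ContDiff ℝ ∞ kap :=
  Complex.ofRealCLM.contDiff.comp (Real.smoothTransition.contDiff.comp (by fun_prop))
lemma kap_one {u : ℝ} (h : 0 ≤ u) : kap u = 1 := by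
  simp [kap, Real.smoothTransition.one_of_one_le (show 1 ≤ u + 1 by linarith)]
lemma kap_zero {u : ℝ} (h : u ≤ -1) : kap u = 0 := by
  simp [kap, Real.smoothTransition.zero_of_nonpos (show u + 1 ≤ 0 by linarith)]

lemma exists_theta : ∃ g : ℝ → ℂ, ContDiff ℝ ∞ g ∧ (∀ r : ℝ, g (r^2) = Complex.cos r) ∧
    ∀ n : ℕ, ∃ C, ∀ x, ‖iteratedDeriv n g x‖ ≤ C := by
  obtain ⟨g, hg, hc⟩ := exists_entire_cos
  have h1 : ∀ r : ℝ, kap (r^2) * g (r^2) = Complex.cos r := fun r => by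
      rw [kap_one (sq_nonneg r), one_mul, hc]
  refine ⟨fun z => kap z * g z, kap_smooth.mul hg, h1, fun n => ?_⟩
  obtain ⟨C, hC⟩ := ext_bound (K := {0}) rfl (kap_smooth.mul hg) Bd_cos h1
    (fun u hu => by simp [kap_zero hu]) 0 n rfl
  exact ⟨C, fun x => by simpa using hC x⟩

lemma Bd_schwartz (f : SchwartzMap ℝ ℂ) : Bd Set.univ f := by
  refine ⟨f.smooth ⊤, fun k _ n => ?_⟩
  obtain ⟨C, -, hC⟩ := f.decay k n
  refine ⟨C, fun r => ?_⟩
  rw [← norm_iteratedFDeriv_eq_norm_iteratedDeriv, ← Real.norm_eq_abs]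
  exact hC r

def Bd.toSchwartz {f : ℝ → ℂ} (h : Bd Set.univ f) : SchwartzMap ℝ ℂ where
  toFun := f
  smooth' := h.1
  decay' k n := by
    obtain ⟨C, hC⟩ := h.2 k trivial n
    refine ⟨C, fun r => ?_⟩
    rw [norm_iteratedFDeriv_eq_norm_iteratedDeriv, Real.norm_eq_abs]
    exact hC r

lemma whitney (b : SchwartzMap ℝ ℂ) (he : ∀ r, b (-r) = b r) :
    ∃ a : SchwartzMap ℝ ℂ, ∀ r : ℝ, a (r^2) = b r := by
  obtain ⟨g, hg, hgc, hgb⟩ := exists_theta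
  let w : SchwartzMap ℝ ℂ := 𝓕 b
  let q : ℝ → ℝ := fun l => (2 * Real.pi * l)^2
  have hq : Continuous q := by fun_prop
  have hsm : ContDiff ℝ ∞ (fun u : ℝ => ∫ l, w l * g (q l * u)) := by
    refine param_smooth volume g hg hgb q hq w w.continuous.aestronglyMeasurable fun k => ?_
    have := (w.integrable_pow_mul volume (2*k)).const_mul (|2 * Real.pi|^(2*k))
    refine this.congr ?_
    filter_upwards with l
    simp only [q]
    rw [abs_pow, ← pow_mul, abs_mul _ l, mul_pow, Real.norm_eq_abs]; ring
  have hval : ∀ r : ℝ, ∫ l, w l * g (q l * r^2) = b r := by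
    have hinv : ∀ r : ℝ, b r = ∫ l : ℝ, Complex.exp (2 * Real.pi * l * r * I) * w l := by
      intro r
      have : 𝓕⁻ (𝓕 b) = b := FourierTransform.fourierInv_fourier_eq b
      conv_lhs => rw [← this]
      rw [SchwartzMap.fourierInv_coe, Real.fourierInv_eq']
      refine integral_congr_ae ?_
      filter_upwards with l
      simp only [smul_eq_mul, w]
      congr 2
      simp
      ring
    have hint : ∀ r : ℝ, Integrable (fun l : ℝ => Complex.exp (2 * Real.pi * l * r * I) * w l) := by
      intro r
      refine w.integrable.norm.mono' (by fun_prop) ?_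
      filter_upwards with l
      rw [norm_mul]
      have : ‖Complex.exp (2 * Real.pi * l * r * I)‖ = 1 := by
        have := Complex.norm_exp_ofReal_mul_I (2 * Real.pi * l * r)
        push_cast at this; exact this
      rw [this, one_mul]
    intro r
    have h2 : b r = (1/2) * (b r + b (-r)) := by rw [he]; ring
    rw [h2, hinv r, hinv (-r), ← integral_add (hint r) (hint (-r)), ← integral_const_mul]
    refine integral_congr_ae ?_
    filter_upwards with l
    simp only [q]
    rw [← mul_pow, hgc, Complex.cos]
    push_cast
    rw [show (2 * Real.pi * l * -r * I : ℂ) = -(2 * Real.pi * l * r) * I by ring]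
    ring
  have hsm2 := kap_smooth.mul hsm
  have hval2 : ∀ r : ℝ, kap (r^2) * (∫ l, w l * g (q l * r^2)) = b r := fun r => by
    rw [kap_one (sq_nonneg r), hval, one_mul]
  have hBd : Bd Set.univ (fun u : ℝ => kap u * (∫ l, w l * g (q l * u))) :=
    ⟨hsm2, fun k _ n => ext_bound (K := Set.univ) trivial hsm2 (Bd_schwartz b) hval2
      (fun u hu => by simp [kap_zero hu]) k n trivial⟩
  exact ⟨hBd.toSchwartz, hval2⟩

lemma schwartz_div (b : SchwartzMap ℝ ℂ) (h : b 0 = 0) :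
    ∃ c : SchwartzMap ℝ ℂ, ∀ r : ℝ, b r = r * c r := by
  obtain ⟨c, hc, h⟩ := hadamard (K := Set.univ) trivial (Bd_schwartz b) h
  exact ⟨hc.toSchwartz, h⟩

lemma schwartz_div_pow (i : ℕ) : ∀ (b : SchwartzMap ℝ ℂ) (_ : ∀ k < i, iteratedDeriv k b 0 = 0),
    ∃ c : SchwartzMap ℝ ℂ, ∀ r : ℝ, b r = r^i * c r := by
  induction i with
  | zero => intro b _; exact ⟨b, by simp⟩
  | succ i ih =>
    intro b hb
    obtain ⟨c, hc⟩ := schwartz_div b (by simpa using hb 0 (by omega))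
    obtain ⟨d, hd⟩ := ih c (fun k hk => by
      have h1 := hb (k+1) (by omega)
      rw [funext hc, iteratedDeriv_id_mul _ (c.smooth ⊤)] at h1
      simp only [ofReal_zero, zero_mul, zero_add, mul_eq_zero] at h1
      exact h1.resolve_left (by exact_mod_cast Nat.succ_ne_zero k))
    exact ⟨d, fun r => by rw [hc, hd]; ring⟩

/-- parity `i`, vanishing to order `i`: `b r = r^i a(r^2)`. -/
lemma schwartz_parity (i : ℕ) (b : SchwartzMap ℝ ℂ) (hp : ∀ r, b (-r) = (-1)^i * b r)
    (hb : ∀ k < i, iteratedDeriv k b 0 = 0) :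
    ∃ a : SchwartzMap ℝ ℂ, ∀ r : ℝ, b r = r^i * a (r^2) := by
  obtain ⟨c, hc⟩ := schwartz_div_pow i b hb
  have : ∀ r, c (-r) = c r := by
    have : (fun r => c (-r)) = c := by
      refine Continuous.ext_on (dense_compl_singleton (0:ℝ)) (by fun_prop) c.continuous ?_
      intro r hr
      have hr' : (r:ℂ) ≠ 0 := by simpa using hr
      have h1 := hp r
      rw [hc, hc] at h1
      push_cast at h1
      rw [neg_pow, mul_assoc] at h1
      have := mul_left_cancel₀ (pow_ne_zero i (by norm_num)) h1
      exact mul_left_cancel₀ (pow_ne_zero i hr') this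
    exact congrFun this
  obtain ⟨a, ha⟩ := whitney c this
  exact ⟨a, fun r => by rw [hc, ha]⟩
end PartB

section PartC
open scoped ContDiff FourierTransform LineDeriv SchwartzMap

set_option linter.unusedSectionVars false
section FTg
variable {V W : Type*} [NormedAddCommGroup V] [NormedSpace ℝ V]
  [MeasureSpace V] [BorelSpace V]
  [NormedAddCommGroup W] [InnerProductSpace ℝ W] [FiniteDimensional ℝ W] [MeasurableSpace W]
  [BorelSpace W]

def FTg (e : V ≃L[ℝ] W) (f : 𝓢(V, ℂ)) : 𝓢(V, ℂ) :=
  SchwartzMap.compCLMOfContinuousLinearEquiv ℂ e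
    (𝓕 (SchwartzMap.compCLMOfContinuousLinearEquiv ℂ e.symm f))

def FTgi (e : V ≃L[ℝ] W) (f : 𝓢(V, ℂ)) : 𝓢(V, ℂ) :=
  SchwartzMap.compCLMOfContinuousLinearEquiv ℂ e
    (𝓕⁻ (SchwartzMap.compCLMOfContinuousLinearEquiv ℂ e.symm f))

lemma sc_symm (e : V ≃L[ℝ] W) (f : 𝓢(W, ℂ)) : SchwartzMap.compCLMOfContinuousLinearEquiv ℂ e.symm
    (SchwartzMap.compCLMOfContinuousLinearEquiv ℂ e f) = f := by
  ext x; simp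

lemma sc_symm' (e : V ≃L[ℝ] W) (f : 𝓢(V, ℂ)) : SchwartzMap.compCLMOfContinuousLinearEquiv ℂ e
    (SchwartzMap.compCLMOfContinuousLinearEquiv ℂ e.symm f) = f := by
  ext x; simp

lemma FTg_FTgi (e : V ≃L[ℝ] W) (f : 𝓢(V, ℂ)) : FTg e (FTgi e f) = f := by
  rw [FTg, FTgi, sc_symm, FourierTransform.fourier_fourierInv_eq, sc_symm']

lemma FTgi_FTg (e : V ≃L[ℝ] W) (f : 𝓢(V, ℂ)) : FTgi e (FTg e f) = f := by
  rw [FTg, FTgi, sc_symm, FourierTransform.fourierInv_fourier_eq, sc_symm']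

lemma FTg_inj (e : V ≃L[ℝ] W) {f g : 𝓢(V, ℂ)} (h : FTg e f = FTg e g) : f = g := by
  rw [← FTgi_FTg e f, h, FTgi_FTg]

lemma FTg_apply (e : V ≃L[ℝ] W) (he : MeasurePreserving e volume volume) (f : 𝓢(V, ℂ)) (ξ : V) :
    FTg e f ξ = ∫ x, Complex.exp (((-2 * Real.pi * inner ℝ (e x) (e ξ) : ℝ) : ℂ) * I) * f x := by
  simp only [FTg, SchwartzMap.compCLMOfContinuousLinearEquiv_apply, Function.comp_apply]
  rw [SchwartzMap.fourier_coe, Real.fourier_eq']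
  rw [← he.integral_comp e.toHomeomorph.measurableEmbedding]
  simp

lemma FTg_comp (e : V ≃L[ℝ] W) (T : V ≃L[ℝ] V)
    (hT : ∀ x y, inner ℝ (e (T x)) (e (T y)) = inner ℝ (e x) (e y)) (f : 𝓢(V, ℂ)) :
    FTg e (SchwartzMap.compCLMOfContinuousLinearEquiv ℂ T f) =
      SchwartzMap.compCLMOfContinuousLinearEquiv ℂ T (FTg e f) := by
  let A : W ≃ₗᵢ[ℝ] W :=
    { toLinearEquiv := ((e.symm.trans T).trans e).toLinearEquiv
      norm_map' := by
        intro x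
        have h := hT (e.symm x) (e.symm x)
        rw [real_inner_self_eq_norm_sq, real_inner_self_eq_norm_sq] at h
        simpa using (sq_eq_sq₀ (norm_nonneg _) (norm_nonneg _)).1 h }
  have hA : ∀ x, A x = e (T (e.symm x)) := fun x => rfl
  ext ξ
  have h := Real.fourier_comp_linearIsometry A (f ∘ e.symm) (e ξ)
  simp only [FTg, SchwartzMap.compCLMOfContinuousLinearEquiv_apply, Function.comp_apply,
    SchwartzMap.fourier_coe]
  rw [hA] at h
  simp only [ContinuousLinearEquiv.symm_apply_apply] at h
  rw [← h]
  have : (⇑f ∘ ⇑T) ∘ ⇑e.symm = (⇑f ∘ ⇑e.symm) ∘ ⇑A := by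
    funext x
    simp [hA]
  rw [this]

/-- derivative -/
lemma FTg_lineDeriv (e : V ≃L[ℝ] W) (f : 𝓢(V, ℂ)) (m : V) :
    ∂_{m} (FTg e f) = FTg e (-(2 * Real.pi * I) •
      SchwartzMap.smulLeftCLM ℂ (fun x => inner ℝ (e x) (e m)) f) := by
  rw [FTg, SchwartzMap.lineDerivOp_compCLMOfContinuousLinearEquiv,
    SchwartzMap.lineDerivOp_fourier_eq, FTg]
  congr 2
  have h1 : (fun x : V => (inner ℝ (e x) (e m) : ℝ)).HasTemperateGrowth := by
    have : (fun x : V => (inner ℝ (e x) (e m) : ℝ)) =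
      fun x => ((innerSL ℝ (e m)).comp (e : V →L[ℝ] W)) x := by
      funext x; simp [real_inner_comm]
    rw [this]
    exact ContinuousLinearMap.hasTemperateGrowth _
  have h2 : (fun x : W => (inner ℝ x (e m) : ℝ)).HasTemperateGrowth := by
    have : (fun x : W => (inner ℝ x (e m) : ℝ)) =
      fun x => ((innerSL ℝ (e m))) x := by
      funext x; simp [real_inner_comm]
    rw [this]
    exact ContinuousLinearMap.hasTemperateGrowth _
  ext x
  simp [SchwartzMap.smulLeftCLM_apply_apply h1, SchwartzMap.smulLeftCLM_apply_apply h2]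
end FTg

/-! the three spaces -/
abbrev E3 := EuclideanSpace ℝ (Fin 3)

def e3 : V3 ≃L[ℝ] E3 := (PiLp.continuousLinearEquiv 2 ℝ (fun _ : Fin 3 => ℝ)).symm
lemma e3_mp : MeasurePreserving e3 volume volume := PiLp.volume_preserving_toLp (Fin 3)
lemma e3_inner (x y : V3) : (inner ℝ (e3 x) (e3 y) : ℝ) = x ⬝ᵥ y := by
  have : ∀ x, e3 x = WithLp.toLp 2 x := fun x => rfl
  rw [this, this, EuclideanSpace.inner_toLp_toLp]
  simp [dotProduct_comm]

def e4 : (V3 × ℝ) ≃L[ℝ] WithLp 2 (E3 × ℝ) :=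
  (e3.prodCongr (ContinuousLinearEquiv.refl ℝ ℝ)).trans
    (WithLp.prodContinuousLinearEquiv 2 ℝ E3 ℝ).symm
lemma e4_mp : MeasurePreserving e4 volume volume :=
  (WithLp.volume_preserving_toLp _ _).comp (e3_mp.prod (MeasurePreserving.id volume))
lemma e4_inner (x y : V3 × ℝ) : (inner ℝ (e4 x) (e4 y) : ℝ) = x.1 ⬝ᵥ y.1 + x.2 * y.2 := by
  have : ∀ x, e4 x = WithLp.toLp 2 (e3 x.1, x.2) := fun x => rfl
  rw [this, this, WithLp.prod_inner_apply]
  simp [e3_inner, mul_comm]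

def e6 : (V3 × V3) ≃L[ℝ] WithLp 2 (E3 × E3) :=
  (e3.prodCongr e3).trans (WithLp.prodContinuousLinearEquiv 2 ℝ E3 E3).symm
lemma e6_mp : MeasurePreserving e6 volume volume :=
  (WithLp.volume_preserving_toLp _ _).comp (e3_mp.prod e3_mp)
lemma e6_inner (x y : V3 × V3) : (inner ℝ (e6 x) (e6 y) : ℝ) = x.1 ⬝ᵥ y.1 + x.2 ⬝ᵥ y.2 := by
  have : ∀ x, e6 x = WithLp.toLp 2 (e3 x.1, e3 x.2) := fun x => rfl
  rw [this, this, WithLp.prod_inner_apply]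
  simp [e3_inner]

abbrev FT3 := FTg e3
abbrev FT4 := FTg e4
abbrev FT6 := FTg e6
end PartC

section PartD
open scoped ContDiff FourierTransform LineDeriv SchwartzMap

set_option linter.unusedSectionVars false
section pint
variable {X Y : Type} [NormedAddCommGroup X] [NormedSpace ℝ X] [NormedAddCommGroup Y]
  [NormedSpace ℝ Y] [MeasurableSpace Y] [BorelSpace Y] [SecondCountableTopology Y]

lemma schwartz_bound1 {E F : Type} [NormedAddCommGroup E] [NormedSpace ℝ E]
    [NormedAddCommGroup F] [NormedSpace ℝ F] (f : 𝓢(E, F)) (k n : ℕ) :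
    ∃ C, 0 ≤ C ∧ ∀ x, (1 + ‖x‖) ^ k * ‖iteratedFDeriv ℝ n f x‖ ≤ C := by
  refine ⟨_, ?_, fun x => SchwartzMap.one_add_le_sup_seminorm_apply (𝕜 := ℝ) (m := (k, n))
    le_rfl le_rfl f x⟩
  positivity

lemma fiber_bound {F : Type} [NormedAddCommGroup F] [NormedSpace ℝ F] (Ψ : 𝓢(X × Y, F)) (k m : ℕ) :
    ∃ C, 0 ≤ C ∧ ∀ x y, (1 + ‖x‖) ^ k * ‖Ψ (x, y)‖ ≤ C * (1 + ‖y‖) ^ (-(m : ℝ)) := by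
  obtain ⟨C, hC0, hC⟩ := schwartz_bound1 Ψ (k + m) 0
  refine ⟨C, hC0, fun x y => ?_⟩
  have h := hC (x, y)
  rw [norm_iteratedFDeriv_zero, pow_add] at h
  rw [Real.rpow_neg (by positivity), Real.rpow_natCast, ← div_eq_mul_inv, le_div_iff₀ (by positivity)]
  refine le_trans ?_ h
  have h1 : ‖x‖ ≤ ‖(x, y)‖ := norm_fst_le (x, y)
  have h2 : ‖y‖ ≤ ‖(x, y)‖ := norm_snd_le (x, y)
  calc _ = (1 + ‖x‖) ^ k * (1 + ‖y‖) ^ m * ‖Ψ (x, y)‖ := by ring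
    _ ≤ _ := by gcongr

variable (μ : Measure Y) [hμ : μ.HasTemperateGrowth]

lemma fiber_integrable {F : Type} [NormedAddCommGroup F] [NormedSpace ℝ F] (Ψ : 𝓢(X × Y, F)) (x : X) :
    Integrable (fun y => Ψ (x, y)) μ := by
  obtain ⟨C, hC0, hC⟩ := fiber_bound Ψ 0 μ.integrablePower
  refine ((μ.integrable_pow_neg_integrablePower).const_mul C).mono'
    (Ψ.continuous.comp (by fun_prop)).aestronglyMeasurable ?_
  filter_upwards with y
  simpa using hC x y

def D1 {F : Type} [NormedAddCommGroup F] [NormedSpace ℝ F] (Ψ : 𝓢(X × Y, F)) :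
    𝓢(X × Y, X →L[ℝ] F) :=
  SchwartzMap.postcompCLM ((ContinuousLinearMap.compL ℝ X (X × Y) F).flip
    (ContinuousLinearMap.inl ℝ X Y)) (SchwartzMap.fderivCLM ℝ (X × Y) F Ψ)

lemma D1_apply {F : Type} [NormedAddCommGroup F] [NormedSpace ℝ F] (Ψ : 𝓢(X × Y, F)) (p : X × Y) :
    D1 Ψ p = (fderiv ℝ Ψ p).comp (ContinuousLinearMap.inl ℝ X Y) := rfl

lemma pint_hasFDerivAt {F : Type} [NormedAddCommGroup F] [NormedSpace ℝ F]
    (Ψ : 𝓢(X × Y, F)) (x : X) :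
    HasFDerivAt (fun x => ∫ y, Ψ (x, y) ∂μ) (∫ y, D1 Ψ (x, y) ∂μ) x := by
  obtain ⟨C, hC0, hC⟩ := fiber_bound (D1 Ψ) 0 μ.integrablePower
  refine hasFDerivAt_integral_of_dominated_of_fderiv_le (𝕜 := ℝ) (s := Set.univ)
    (F := fun x y => Ψ (x, y)) (F' := fun x y => D1 Ψ (x, y))
    (bound := fun y => C * (1 + ‖y‖) ^ (-(μ.integrablePower : ℝ))) Filter.univ_mem ?_
    (fiber_integrable μ Ψ x) (fiber_integrable μ (D1 Ψ) x).aestronglyMeasurable ?_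
    ((μ.integrable_pow_neg_integrablePower).const_mul C) ?_
  · filter_upwards with x using (fiber_integrable μ Ψ x).aestronglyMeasurable
  · filter_upwards with y x _
    simpa using hC x y
  · filter_upwards with y x _
    have h1 : HasFDerivAt Ψ (fderiv ℝ Ψ (x, y)) (x, y) := Ψ.differentiableAt.hasFDerivAt
    exact h1.comp x (hasFDerivAt_prodMk_left x y)

lemma pint_contDiff (n : ℕ) : ∀ {F : Type} [NormedAddCommGroup F] [NormedSpace ℝ F]
    (Ψ : 𝓢(X × Y, F)), ContDiff ℝ n (fun x => ∫ y, Ψ (x, y) ∂μ) := by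
  induction n with
  | zero =>
    intro F _ _ Ψ
    refine contDiff_zero.2 (continuous_iff_continuousAt.2 fun x =>
      (pint_hasFDerivAt μ Ψ x).continuousAt)
  | succ n ih =>
    intro F _ _ Ψ
    push_cast
    rw [contDiff_succ_iff_fderiv]
    refine ⟨fun x => (pint_hasFDerivAt μ Ψ x).differentiableAt, by simp, ?_⟩
    have : fderiv ℝ (fun x => ∫ y, Ψ (x, y) ∂μ) = fun x => ∫ y, D1 Ψ (x, y) ∂μ :=
      funext fun x => (pint_hasFDerivAt μ Ψ x).fderiv
    rw [this]
    exact ih (D1 Ψ)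

lemma pint_decay (k n : ℕ) : ∀ {F : Type} [NormedAddCommGroup F] [NormedSpace ℝ F]
    (Ψ : 𝓢(X × Y, F)), ∃ C, ∀ x, ‖x‖ ^ k * ‖iteratedFDeriv ℝ n (fun x => ∫ y, Ψ (x, y) ∂μ) x‖ ≤ C := by
  induction n with
  | zero =>
    intro F _ _ Ψ
    obtain ⟨C, hC0, hC⟩ := fiber_bound Ψ k μ.integrablePower
    refine ⟨∫ y, C * (1 + ‖y‖) ^ (-(μ.integrablePower : ℝ)) ∂μ, fun x => ?_⟩
    rw [norm_iteratedFDeriv_zero]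
    calc _ ≤ (1 + ‖x‖) ^ k * ∫ y, ‖Ψ (x, y)‖ ∂μ := by
          gcongr
          · linarith
          · exact norm_integral_le_integral_norm _
      _ = ∫ y, (1 + ‖x‖) ^ k * ‖Ψ (x, y)‖ ∂μ := (integral_const_mul _ _).symm
      _ ≤ _ := integral_mono ((fiber_integrable μ Ψ x).norm.const_mul _)
          ((μ.integrable_pow_neg_integrablePower).const_mul C) (hC x)
  | succ n ih =>
    intro F _ _ Ψ
    obtain ⟨C, hC⟩ := ih (D1 Ψ)
    refine ⟨C, fun x => ?_⟩
    have : fderiv ℝ (fun x => ∫ y, Ψ (x, y) ∂μ) = fun x => ∫ y, D1 Ψ (x, y) ∂μ :=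
      funext fun x => (pint_hasFDerivAt μ Ψ x).fderiv
    rw [← norm_iteratedFDeriv_fderiv, this]
    exact hC x

def pint {F : Type} [NormedAddCommGroup F] [NormedSpace ℝ F] (Ψ : 𝓢(X × Y, F)) : 𝓢(X, F) where
  toFun := fun x => ∫ y, Ψ (x, y) ∂μ
  smooth' := contDiff_infty.2 fun n => pint_contDiff μ n Ψ
  decay' k n := pint_decay μ k n Ψ

lemma pint_apply {F : Type} [NormedAddCommGroup F] [NormedSpace ℝ F] (Ψ : 𝓢(X × Y, F)) (x : X) :
    pint μ Ψ x = ∫ y, Ψ (x, y) ∂μ := rfl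
end pint
end PartD

section PartE
open scoped ContDiff FourierTransform LineDeriv SchwartzMap

section van
variable {X : Type} [NormedAddCommGroup X] [NormedSpace ℝ X]

def ds {F : Type} [NormedAddCommGroup F] [NormedSpace ℝ F] (f : 𝓢(X × ℝ, F)) : 𝓢(X × ℝ, F) :=
  ∂_{((0:X), (1:ℝ))} f

lemma ds_apply {F : Type} [NormedAddCommGroup F] [NormedSpace ℝ F] (f : 𝓢(X × ℝ, F)) (p : X × ℝ) :
    ds f p = fderiv ℝ f p (0, 1) := SchwartzMap.lineDerivOp_apply_eq_fderiv _ _ _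

lemma ds_hasDerivAt {F : Type} [NormedAddCommGroup F] [NormedSpace ℝ F] (f : 𝓢(X × ℝ, F))
    (x : X) (s : ℝ) : HasDerivAt (fun s => f (x, s)) (ds f (x, s)) s := by
  rw [ds_apply]
  exact (f.hasFDerivAt (x, s)).comp_hasDerivAt s
    ((hasDerivAt_const s x).prodMk (hasDerivAt_id s))

lemma ds_iter {F : Type} [NormedAddCommGroup F] [NormedSpace ℝ F] (l : ℕ) : ∀ (f : 𝓢(X × ℝ, F))
    (x : X) (s : ℝ), (ds^[l] f) (x, s) = iteratedDeriv l (fun s => f (x, s)) s := by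
  induction l with
  | zero => intro f x s; simp
  | succ l ih =>
    intro f x s
    rw [Function.iterate_succ_apply, ih, iteratedDeriv_succ']
    congr 1
    funext s
    exact (ds_hasDerivAt f x s).deriv.symm

def Van {F : Type} [NormedAddCommGroup F] [NormedSpace ℝ F] (N : ℕ) (f : 𝓢(X × ℝ, F)) : Prop :=
  ∀ l < N, ∀ x, (ds^[l] f) (x, 0) = 0

lemma Van.bound (N k : ℕ) : ∀ {F : Type} [NormedAddCommGroup F] [NormedSpace ℝ F]
    (f : 𝓢(X × ℝ, F)) (_ : Van N f), ∃ C, 0 ≤ C ∧ ∀ p : X × ℝ,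
      (1 + ‖p‖) ^ k * ‖f p‖ ≤ C * (min 1 |p.2|) ^ N := by
  induction N with
  | zero =>
    intro F _ _ f _
    obtain ⟨C, h0, hC⟩ := schwartz_bound1 f k 0
    exact ⟨C, h0, fun p => by simpa using hC p⟩
  | succ N ih =>
    intro F _ _ f hf
    obtain ⟨C0, h0, hC0⟩ := schwartz_bound1 f k 0
    obtain ⟨C, h1, hC⟩ := ih (ds f) (fun l hl x => by
      have := hf (l+1) (by omega) x
      rwa [Function.iterate_succ_apply] at this)
    refine ⟨max C0 (2^k * C), le_max_of_le_left h0, ?_⟩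
    rintro ⟨x, s⟩
    rcases le_or_gt |s| 1 with hs | hs
    · have key : ‖f (x, s) - f (x, 0)‖ ≤ C * |s|^N / (1 + ‖x‖)^k * ‖s - 0‖ := by
        refine Convex.norm_image_sub_le_of_norm_hasDerivWithin_le (f := fun s => f (x, s))
          (f' := fun s => ds f (x, s)) (s := Metric.closedBall 0 |s|)
          (fun σ _ => (ds_hasDerivAt f x σ).hasDerivWithinAt) ?_ (convex_closedBall _ _) ?_ ?_
        · intro σ hσ
          have hσ' : |σ| ≤ |s| := by simpa using hσ
          rw [le_div_iff₀ (by positivity), mul_comm]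
          have h2 := hC (x, σ)
          have h3 : ‖x‖ ≤ ‖(x, σ)‖ := norm_fst_le (x, σ)
          calc _ ≤ (1 + ‖(x, σ)‖) ^ k * ‖(ds f) (x, σ)‖ := by gcongr
            _ ≤ _ := h2
            _ ≤ _ := by
              gcongr
              exact (min_le_right _ _).trans hσ'
        · simp
        · simp
      have h00 := hf 0 (by omega) x
      simp only [Function.iterate_zero, id] at h00
      rw [h00, sub_zero, sub_zero, Real.norm_eq_abs, div_mul_eq_mul_div, le_div_iff₀ (by positivity)] at key
      have h4 : 1 + ‖(x, s)‖ ≤ 2 * (1 + ‖x‖) := by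
        have : ‖(x, s)‖ ≤ ‖x‖ + 1 := by
          rw [Prod.norm_mk]
          exact max_le (by linarith) (by rw [Real.norm_eq_abs]; linarith [norm_nonneg x])
        linarith [norm_nonneg x]
      simp only
      rw [min_eq_right hs]
      calc _ ≤ (2 * (1 + ‖x‖)) ^ k * ‖f (x, s)‖ := by gcongr
        _ = 2 ^ k * (‖f (x, s)‖ * (1 + ‖x‖) ^ k) := by rw [mul_pow]; ring
        _ ≤ 2 ^ k * (C * |s| ^ N * |s|) := by gcongr
        _ = (2 ^ k * C) * |s|^(N+1) := by ring
        _ ≤ _ := by gcongr; exact le_max_right _ _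
    · simp only
      rw [min_eq_left hs.le, one_pow, mul_one]
      have := hC0 (x, s)
      rw [norm_iteratedFDeriv_zero] at this
      exact this.trans (le_max_left _ _)

lemma ds_fderiv {F : Type} [NormedAddCommGroup F] [NormedSpace ℝ F] (f : 𝓢(X × ℝ, F)) :
    ds (SchwartzMap.fderivCLM ℝ _ _ f) = SchwartzMap.fderivCLM ℝ _ _ (ds f) := by
  ext1 p
  refine ContinuousLinearMap.ext fun v => ?_
  have h1 : HasFDerivAt (fderiv ℝ f) (fderiv ℝ (fderiv ℝ f) p) p :=
    (SchwartzMap.fderivCLM ℝ _ _ f).hasFDerivAt p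
  have h := second_derivative_symmetric (f := f) (fun y => f.hasFDerivAt y) h1 (0, 1) v
  rw [ds_apply, SchwartzMap.fderivCLM_apply]
  have e1 : ⇑(SchwartzMap.fderivCLM ℝ _ _ f) = fderiv ℝ f := rfl
  have e2 : ⇑(ds f) = fun p => fderiv ℝ f p (0, 1) := funext (ds_apply f)
  rw [e1, e2, h]
  have := (h1.clm_apply (hasFDerivAt_const ((0:X), (1:ℝ)) p)).fderiv
  rw [this]
  simp

lemma ds_fderiv_iter {F : Type} [NormedAddCommGroup F] [NormedSpace ℝ F] (l : ℕ) :
    ∀ (f : 𝓢(X × ℝ, F)),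
    ds^[l] (SchwartzMap.fderivCLM ℝ _ _ f) = SchwartzMap.fderivCLM ℝ _ _ (ds^[l] f) := by
  induction l with
  | zero => intro f; rfl
  | succ l ih => intro f; rw [Function.iterate_succ_apply, ds_fderiv, ih, Function.iterate_succ_apply]

lemma Van.fd {F : Type} [NormedAddCommGroup F] [NormedSpace ℝ F] {N : ℕ} {f : 𝓢(X × ℝ, F)}
    (hf : Van N f) : Van (N - 1) (SchwartzMap.fderivCLM ℝ _ _ f) := by
  intro l hl x
  rw [ds_fderiv_iter]
  refine ContinuousLinearMap.ext fun v => ?_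
  set g := ds^[l] f with hg
  have h0 : ∀ x, g (x, 0) = 0 := hf l (by omega)
  have h1 : fderiv ℝ g (x, 0) (0, 1) = 0 := by
    have := hf (l+1) (by omega) x
    rwa [Function.iterate_succ_apply', ds_apply] at this
  obtain ⟨a, b⟩ := v
  have h2 : fderiv ℝ g (x, 0) (a, 0) = 0 := by
    have e := HasFDerivAt.comp (f := fun x => (x, (0:ℝ))) x (g.hasFDerivAt (x, (0:ℝ)))
      (hasFDerivAt_prodMk_left x (0:ℝ))
    have e2 : (⇑g ∘ fun x => (x, (0:ℝ))) = fun _ => 0 := funext h0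
    rw [e2] at e
    have := congrArg (fun L => L a) (e.unique (hasFDerivAt_const (0:F) x))
    simpa using this
  have : ((a, b) : X × ℝ) = (a, 0) + b • (0, 1) := by simp
  rw [SchwartzMap.fderivCLM_apply, this, map_add, map_smul, h1, h2]
  simp

lemma Van.bound' (k i : ℕ) : ∀ (N : ℕ) {F : Type} [NormedAddCommGroup F] [NormedSpace ℝ F]
    (f : 𝓢(X × ℝ, F)) (_ : Van N f), ∃ C, 0 ≤ C ∧ ∀ p : X × ℝ,
      (1 + ‖p‖) ^ k * ‖iteratedFDeriv ℝ i f p‖ ≤ C * (min 1 |p.2|) ^ (N - i) := by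
  induction i with
  | zero =>
    intro N F _ _ f hf
    simpa using Van.bound N k f hf
  | succ i ih =>
    intro N F _ _ f hf
    obtain ⟨C, h0, hC⟩ := ih (N - 1) _ hf.fd
    refine ⟨C, h0, fun p => ?_⟩
    have := hC p
    have e1 : ⇑(SchwartzMap.fderivCLM ℝ _ _ f) = fderiv ℝ f := rfl
    rw [e1, norm_iteratedFDeriv_fderiv, show N - 1 - i = N - (i + 1) by omega] at this
    exact this
end van
end PartE

section PartF
open scoped ContDiff FourierTransform LineDeriv SchwartzMap

instance instHaarVV : (volume : Measure (V3 × V3)).IsAddHaarMeasure :=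
  Measure.prod.instIsAddHaarMeasure (volume : Measure V3) (volume : Measure V3)
instance instTempVV : (volume : Measure (V3 × V3)).HasTemperateGrowth := inferInstance
instance instTempVR : (volume : Measure (V3 × ℝ)).HasTemperateGrowth :=
  inferInstanceAs (((volume : Measure V3).prod (volume : Measure ℝ)).HasTemperateGrowth)

lemma mp3 : MeasurePreserving (fun q : ℝ × (ℝ × ℝ) => (![q.2.1, q.2.2, q.1] : V3)) volume volume := by
  have h1 := (volume_preserving_piFinSuccAbove (fun _ : Fin 3 => ℝ) 2).symm
  have h2 := (volume_preserving_finTwoArrow ℝ).symm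
  have h3 := h1.comp ((MeasurePreserving.id (volume : Measure ℝ)).prod h2)
  have h4 : (fun q : ℝ × (ℝ × ℝ) => (![q.2.1, q.2.2, q.1] : V3)) =
    ((MeasurableEquiv.piFinSuccAbove (fun _ : Fin 3 => ℝ) 2).symm ∘
      Prod.map id (MeasurableEquiv.finTwoArrow (α := ℝ)).symm) := ?_
  · rw [h4]; exact h3
  funext q
  funext i
  fin_cases i <;> simp [MeasurableEquiv.piFinSuccAbove, MeasurableEquiv.finTwoArrow, Fin.insertNthEquiv, Fin.insertNth, Fin.succAboveCases]

/-- linear equivalence `(x,t),(w₁,w₂) ↦ (x,(w₁,w₂,t))`. -/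
def L36 : ((V3 × ℝ) × (ℝ × ℝ)) ≃L[ℝ] (V3 × V3) :=
  LinearEquiv.toContinuousLinearEquiv
  { toFun := fun p => (p.1.1, ![p.2.1, p.2.2, p.1.2])
    invFun := fun p => ((p.1, p.2 2), (p.2 0, p.2 1))
    map_add' := by
      intro p q
      ext i
      · simp
      · fin_cases i <;> simp
    map_smul' := by
      intro c p
      ext i
      · simp
      · fin_cases i <;> simp
    left_inv := by intro p; simp
    right_inv := by
      intro p
      ext i
      · simp
      · fin_cases i <;> simp }

lemma L36_apply (p) : L36 p = (p.1.1, ![p.2.1, p.2.2, p.1.2]) := rfl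

lemma L36_mp : MeasurePreserving L36 volume volume := by
  have h1 : MeasurePreserving (MeasurableEquiv.prodAssoc : (V3 × ℝ) × (ℝ × ℝ) ≃ᵐ V3 × (ℝ × (ℝ × ℝ)))
    volume volume := volume_preserving_prodAssoc
  exact ((MeasurePreserving.id (volume : Measure V3)).prod mp3).comp h1

def rad (F : 𝓢(V3 × V3, ℂ)) : 𝓢(V3 × ℝ, ℂ) :=
  pint volume (SchwartzMap.compCLMOfContinuousLinearEquiv ℂ L36 F)

lemma rad_apply (F : 𝓢(V3 × V3, ℂ)) (x : V3) (t : ℝ) : rad F (x, t) = RadonT F x t := rfl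

lemma exp_bdd_integrable {V : Type} [MeasureSpace V] {h : V → ℝ} {f : V → ℂ}
    (hf : Integrable f) (hh : AEStronglyMeasurable h volume) :
    Integrable (fun x => Complex.exp (((h x : ℝ) : ℂ) * I) * f x) := by
  refine hf.norm.mono' ?_ ?_
  · refine AEStronglyMeasurable.mul ?_ hf.1
    exact Complex.continuous_exp.comp_aestronglyMeasurable
      ((Complex.continuous_ofReal.comp_aestronglyMeasurable hh).mul_const I)
  · filter_upwards with x
    rw [norm_mul, Complex.norm_exp_ofReal_mul_I, one_mul]

lemma FT4_rad (F : 𝓢(V3 × V3, ℂ)) (ξ : V3) (s : ℝ) : FT4 (rad F) (ξ, s) = FT6 F (ξ, ![0, 0, s]) := by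
  rw [FTg_apply e4 e4_mp, FTg_apply e6 e6_mp]
  rw [← L36_mp.integral_comp L36.toHomeomorph.measurableEmbedding]
  have hi : Integrable (fun p : (V3 × ℝ) × (ℝ × ℝ) =>
     Complex.exp (((-2 * Real.pi * inner ℝ (e6 (L36 p)) (e6 (ξ, ![0, 0, s])) : ℝ) : ℂ) * I) * F (L36 p))
      (volume.prod volume) := by
    refine exp_bdd_integrable (L36_mp.integrable_comp_of_integrable (F.integrable (μ := volume))) ?_
    exact Continuous.aestronglyMeasurable (by fun_prop)
  refine Eq.trans ?_ (integral_prod _ hi).symm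
  refine integral_congr_ae ?_
  filter_upwards with p
  obtain ⟨x, t⟩ := p
  rw [rad_apply, RadonT, ← integral_const_mul]
  refine integral_congr_ae ?_
  filter_upwards with w
  rw [L36_apply]
  simp only [e4_inner, e6_inner]
  congr 4
  simp [dotProduct, Fin.sum_univ_three]

def tm : 𝓢(V3 × ℝ, ℂ) →L[ℝ] 𝓢(V3 × ℝ, ℂ) :=
  SchwartzMap.smulLeftCLM ℂ (fun p : V3 × ℝ => p.2)

lemma tm_apply (f : 𝓢(V3 × ℝ, ℂ)) (p) : tm f p = p.2 * f p := by
  have : (fun p : V3 × ℝ => p.2).HasTemperateGrowth :=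
    (ContinuousLinearMap.snd ℝ V3 ℝ).hasTemperateGrowth
  rw [tm, SchwartzMap.smulLeftCLM_apply_apply this]; simp

lemma tm_iter (j : ℕ) (f : 𝓢(V3 × ℝ, ℂ)) (p) : (tm^[j] f) p = p.2 ^ j * f p := by
  induction j with
  | zero => simp
  | succ j ih => rw [Function.iterate_succ_apply', tm_apply, ih]; ring

def mom (j : ℕ) (G : 𝓢(V3 × ℝ, ℂ)) : 𝓢(V3, ℂ) := pint volume (tm^[j] G)

lemma mom_apply (j : ℕ) (G : 𝓢(V3 × ℝ, ℂ)) (x : V3) : mom j G x = ∫ t : ℝ, G (x, t) * (t:ℂ)^j := by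
  rw [mom, pint_apply]
  refine integral_congr_ae ?_
  filter_upwards with t
  rw [tm_iter, mul_comm]

lemma FT4_zero (G : 𝓢(V3 × ℝ, ℂ)) (ξ : V3) : FT4 G (ξ, 0) = FT3 (pint volume G) ξ := by
  rw [FTg_apply e4 e4_mp, FTg_apply e3 e3_mp]
  rw [Measure.volume_eq_prod, integral_prod]
  · refine integral_congr_ae ?_
    filter_upwards with x
    rw [pint_apply, ← integral_const_mul]
    refine integral_congr_ae ?_
    filter_upwards with t
    simp only [e3_inner, e4_inner]
    simp
  · exact exp_bdd_integrable (G.integrable (μ := volume)) (Continuous.aestronglyMeasurable (by fun_prop))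

lemma FTg_smul4 (c : ℂ) (f : 𝓢(V3 × ℝ, ℂ)) : FT4 (c • f) = c • FT4 f := by
  simp only [FTg, map_smul, FourierTransform.fourier_smul]

lemma ds_smul (c : ℂ) (f : 𝓢(V3 × ℝ, ℂ)) : ds (c • f) = c • ds f := by
  ext p
  rw [ds_apply]
  have : ⇑(c • f) = fun p => c • f p := rfl
  rw [this, fderiv_fun_const_smul f.differentiableAt]
  change _ = c • ds f p
  rw [ds_apply]; rfl

lemma ds_FT4 (G : 𝓢(V3 × ℝ, ℂ)) : ds (FT4 G) = (-(2 * Real.pi * I)) • FT4 (tm G) := by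
  rw [ds, FTg_lineDeriv, show ∀ c f, FTg e4 (c • f) = c • FT4 f from FTg_smul4]
  congr 2
  have : (fun x => inner ℝ (e4 x) (e4 ((0:V3), (1:ℝ)))) = fun p : V3 × ℝ => p.2 := by
    funext p; rw [e4_inner]; simp
  rw [this]
  rfl

lemma ds_FT4_iter (j : ℕ) : ∀ (G : 𝓢(V3 × ℝ, ℂ)),
    ds^[j] (FT4 G) = (-(2 * Real.pi * I))^j • FT4 (tm^[j] G) := by
  induction j with
  | zero => intro G; simp
  | succ j ih =>
    intro G
    rw [Function.iterate_succ_apply', ih, ds_smul, ds_FT4, smul_smul, pow_succ,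
      ← Function.iterate_succ_apply' (f := tm)]

lemma ds_FT4_zero (j : ℕ) (G : 𝓢(V3 × ℝ, ℂ)) (ξ : V3) :
    (ds^[j] (FT4 G)) (ξ, 0) = (-(2 * Real.pi * I))^j * FT3 (mom j G) ξ := by
  rw [ds_FT4_iter, _root_.smul_apply, FT4_zero]; rfl

/-- orthogonal matrices as CLEs -/
def oL (A : Mat3) (h : A * A.transpose = 1) : V3 ≃L[ℝ] V3 :=
  LinearEquiv.toContinuousLinearEquiv
  { toFun := fun x => A *ᵥ x
    invFun := fun x => Aᵀ *ᵥ x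
    map_add' := mulVec_add A
    map_smul' := fun c x => mulVec_smul A c x
    left_inv := by intro x; simp [mulVec_mulVec, mul_eq_one_comm.1 h]
    right_inv := by intro x; simp [mulVec_mulVec, h] }
lemma oL_apply (A : Mat3) (h : A * A.transpose = 1) (x : V3) : oL A h x = A *ᵥ x := rfl

lemma orth_dot {A : Mat3} (h : A * A.transpose = 1) (x y : V3) : (A *ᵥ x) ⬝ᵥ (A *ᵥ y) = x ⬝ᵥ y := by
  rw [dotProduct_mulVec, vecMul_mulVec, mul_eq_one_comm.1 h]; simp

lemma FT6_orth {A : Mat3} (h : A * A.transpose = 1) (f : 𝓢(V3 × V3, ℂ)) :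
    FT6 (SchwartzMap.compCLMOfContinuousLinearEquiv ℂ ((oL A h).prodCongr (oL A h)) f) =
    SchwartzMap.compCLMOfContinuousLinearEquiv ℂ ((oL A h).prodCongr (oL A h)) (FT6 f) := by
  apply FTg_comp
  intro x y
  rw [e6_inner, e6_inner]
  simp [oL_apply, orth_dot h]

lemma FT3_orth {A : Mat3} (h : A * A.transpose = 1) (f : 𝓢(V3, ℂ)) :
    FT3 (SchwartzMap.compCLMOfContinuousLinearEquiv ℂ (oL A h) f) =
    SchwartzMap.compCLMOfContinuousLinearEquiv ℂ (oL A h) (FT3 f) := by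
  apply FTg_comp
  intro x y
  rw [e3_inner, e3_inner]
  simp [oL_apply, orth_dot h]

lemma orth_mp {A : Mat3} (h : A * A.transpose = 1) : MeasurePreserving (fun x : V3 => A *ᵥ x) volume volume := by
  have hd : A.det * A.det = 1 := by
    have := congrArg Matrix.det h
    rwa [det_mul, det_transpose, det_one] at this
  have hd' : |A.det| = 1 := by
    have : |A.det| * |A.det| = 1 := by rw [← abs_mul, hd, abs_one]
    nlinarith [abs_nonneg A.det]
  refine ⟨by fun_prop, ?_⟩
  have := Real.map_matrix_volume_pi_eq_smul_volume_pi (M := A) (by intro h0; rw [h0] at hd; simp at hd)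
  rw [abs_inv, hd'] at this
  have e : (fun x : V3 => A *ᵥ x) = toLin' A := by funext x; simp
  rw [e]
  simpa using this
end PartF

section PartG
open scoped ContDiff FourierTransform LineDeriv SchwartzMap

open Polynomial in
def Ev (l n : ℕ) : Polynomial ℂ := if Even l then X ^ n * (1 - X ^ 2) ^ (l / 2) else 0

lemma Ev_eval (l n : ℕ) {s c : ℝ} (h : s ^ 2 + c ^ 2 = 1) :
    (Ev l n).eval (c : ℂ) = (1/2) * (((s:ℂ)^l + (-(s:ℂ)) ^ l) * (c:ℂ) ^ n) := by
  have h' : (1:ℂ) - (c:ℂ)^2 = (s:ℂ)^2 := by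
    have : (s:ℂ)^2 + (c:ℂ)^2 = 1 := by exact_mod_cast h
    rw [← this]; ring
  by_cases hl : Even l
  · obtain ⟨k, hk⟩ := hl
    have hl2 : l / 2 = k := by omega
    have hl3 : l = 2 * k := by omega
    rw [Ev, if_pos ⟨k, hk⟩]
    simp only [Polynomial.eval_mul, Polynomial.eval_pow, Polynomial.eval_sub, Polynomial.eval_X,
      Polynomial.eval_one]
    rw [h', hl2, hl3, pow_mul, pow_mul, neg_sq]; ring
  · rw [Ev, if_neg hl, (Nat.not_even_iff_odd.1 hl).neg_pow]; simp

lemma Ev_deg (l n : ℕ) : (Ev l n).natDegree ≤ l + n := by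
  rw [Ev]
  split_ifs with h
  · refine (Polynomial.natDegree_mul_le).trans ?_
    refine (add_le_add Polynomial.natDegree_pow_le Polynomial.natDegree_pow_le).trans ?_
    have h2 : (1 - Polynomial.X ^ 2 : Polynomial ℂ).natDegree ≤ 2 := by
      refine (Polynomial.natDegree_sub_le _ _).trans ?_
      simp
    have h1 : (Polynomial.X : Polynomial ℂ).natDegree ≤ 1 := Polynomial.natDegree_X_le
    have : l / 2 * 2 ≤ l := Nat.div_mul_le_self l 2
    nlinarith [Nat.mul_le_mul_left n h1, Nat.mul_le_mul_left (l/2) h2]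
  · simp

lemma poly_eq {p q : Polynomial ℂ} (h : ∀ s c : ℝ, s ^ 2 + c ^ 2 = 1 → p.eval (c:ℂ) = q.eval (c:ℂ)) :
    p = q := by
  refine Polynomial.eq_of_infinite_eval_eq p q ?_
  have : Set.Infinite ((fun c : ℝ => (c:ℂ)) '' Set.Icc (-1) 1) :=
    (Set.Icc_infinite (by norm_num)).image (Complex.ofReal_injective.injOn)
  refine this.mono ?_
  rintro _ ⟨c, hc, rfl⟩
  refine h √(1 - c^2) c ?_
  rw [Real.sq_sqrt (by nlinarith [hc.1, hc.2])]; ring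

lemma coeff_sum_CX (j : ℕ) (b : ℕ → ℂ) (i : ℕ) (hi : i < j) :
    (∑ i ∈ Finset.range j, Polynomial.C (b i) * Polynomial.X ^ i).coeff i = b i := by
  simp only [Polynomial.finset_sum_coeff, Polynomial.coeff_C_mul_X_pow]
  rw [Finset.sum_ite_eq]; simp [hi]

lemma line_deriv_poly (φ : 𝓢(V3, ℂ)) (k : ℕ) : ∃ P : Polynomial ℂ, P.natDegree ≤ k ∧
    ∀ s c : ℝ, s ^ 2 + c ^ 2 = 1 →
     P.eval (c:ℂ) = (1/2) * (iteratedDeriv k (fun r : ℝ => φ ![r * s, 0, r * c]) 0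
      + iteratedDeriv k (fun r : ℝ => φ ![r * -s, 0, r * c]) 0) := by
  set f := iteratedFDeriv ℝ k φ 0 with hf
  have key : ∀ s c : ℝ, iteratedDeriv k (fun r : ℝ => φ ![r * s, 0, r * c]) 0 =
      ∑ S : Finset (Fin k), ((s:ℂ) ^ S.card * (c:ℂ)^(k - S.card)) *
        f (S.piecewise (fun _ => ![1,0,0]) (fun _ => ![0,0,1])) := by
    intro s c
    have e1 : (fun r : ℝ => φ ![r * s, 0, r * c]) =
        φ ∘ (ContinuousLinearMap.toSpanSingleton ℝ (![s, 0, c] : V3)) := by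
      funext r; simp [ContinuousLinearMap.toSpanSingleton_apply]
    rw [e1, iteratedDeriv_eq_iteratedFDeriv,
      ContinuousLinearMap.iteratedFDeriv_comp_right _ (φ.smooth k) _ le_rfl]
    simp only [map_zero, ContinuousMultilinearMap.compContinuousLinearMap_apply,
      ContinuousLinearMap.toSpanSingleton_apply, one_smul, ← hf]
    have e2 : (fun _ : Fin k => (![s, 0, c] : V3)) = (fun _ => s • ![1,0,0]) + fun _ => c • ![0,0,1] := by
      funext i; simp
    rw [e2, ContinuousMultilinearMap.map_add_univ]
    refine Finset.sum_congr rfl fun S _ => ?_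
    have e3 : S.piecewise (fun _ : Fin k => s • (![1,0,0] : V3)) (fun _ => c • ![0,0,1]) =
      fun i => (if i ∈ S then s else c) • S.piecewise (fun _ : Fin k => (![1,0,0] : V3)) (fun _ => ![0,0,1]) i := by
      funext i
      by_cases hi : i ∈ S <;> simp [hi]
    rw [e3, ContinuousMultilinearMap.map_smul_univ, Finset.prod_ite]
    have e4 : Finset.univ.filter (fun i => i ∈ S) = S := by ext; simp
    have e5 : Finset.univ.filter (fun i => i ∉ S) = Sᶜ := by ext; simp
    rw [e4, e5, Finset.prod_const, Finset.prod_const, Finset.card_compl, Fintype.card_fin]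
    simp
  refine ⟨∑ S : Finset (Fin k), Polynomial.C
    (f (S.piecewise (fun _ => ![1,0,0]) (fun _ => ![0,0,1]))) * Ev S.card (k - S.card), ?_, ?_⟩
  · refine Polynomial.natDegree_sum_le_of_forall_le _ _ fun S _ => ?_
    refine (Polynomial.natDegree_C_mul_le _ _).trans ((Ev_deg _ _).trans ?_)
    have : S.card ≤ k := by simpa using Finset.card_le_univ S
    omega
  · intro s c h
    rw [key, key, Polynomial.eval_finset_sum, ← Finset.sum_add_distrib, Finset.mul_sum]
    refine Finset.sum_congr rfl fun S _ => ?_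
    rw [Polynomial.eval_mul, Polynomial.eval_C, Ev_eval _ _ h]
    push_cast
    ring

lemma forward_core (φ : 𝓢(V3, ℂ)) (j : ℕ) (cc : ℕ → 𝓢(ℝ, ℂ))
    (h1 : ∀ s c r : ℝ, s ^ 2 + c ^ 2 = 1 → φ ![r * s, 0, r * c] =
      ∑ m ∈ Finset.range (j + 1), (j.choose m : ℂ) * ((c:ℂ) ^ m * (-(s:ℂ)) ^ (j - m)) * cc m r)
    (h2 : ∀ x z : ℝ, φ ![-x, 0, z] = φ ![x, 0, z])
    (h3 : ∀ x : V3, φ x = φ ![√(x 0 ^ 2 + x 1 ^ 2), 0, x 2]) :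
    ∃ a : ℕ → 𝓢(ℝ, ℂ), ∀ x : V3, φ x =
      ∑ i ∈ Finset.range (j + 1), a i (x 0 ^ 2 + x 1 ^ 2 + x 2 ^ 2) * (x 2 : ℂ) ^ i := by
  let Q : ℕ → Polynomial ℂ := fun m => Polynomial.C (j.choose m : ℂ) * Ev (j - m) m
  have hQd : ∀ m ∈ Finset.range (j+1), (Q m).natDegree < j + 1 := fun m hm => by
    have := Finset.mem_range.1 hm
    refine Nat.lt_succ_of_le ((Polynomial.natDegree_C_mul_le _ _).trans ((Ev_deg _ _).trans ?_))
    omega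
  let b : ℕ → 𝓢(ℝ, ℂ) := fun i => ∑ m ∈ Finset.range (j + 1), (Q m).coeff i • cc m
  have hbv : ∀ i r, b i r = ∑ m ∈ Finset.range (j + 1), (Q m).coeff i * cc m r := by
    intro i r
    simp [b]
  have hb : ∀ s c r : ℝ, s ^ 2 + c ^ 2 = 1 → φ ![r * s, 0, r * c] =
      ∑ i ∈ Finset.range (j + 1), b i r * (c:ℂ) ^ i := by
    intro s c r h
    have e1 : φ ![r * s, 0, r * c] = (1/2) * (φ ![r * s, 0, r * c] + φ ![r * -s, 0, r * c]) := by
      rw [mul_neg, h2]; ring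
    rw [e1, h1 s c r h, h1 (-s) c r (by rw [neg_sq]; exact h), ← Finset.sum_add_distrib, Finset.mul_sum]
    have e2 : ∀ m ∈ Finset.range (j+1), (1/2 : ℂ) * ((j.choose m : ℂ) * ((c:ℂ) ^ m * (-(s:ℂ)) ^ (j - m)) * cc m r
        + (j.choose m : ℂ) * ((c:ℂ) ^ m * (-((-s : ℝ):ℂ)) ^ (j - m)) * cc m r)
        = ∑ i ∈ Finset.range (j + 1), (Q m).coeff i * cc m r * (c:ℂ)^i := by
      intro m hm
      have e3 : (Q m).eval (c:ℂ) = ∑ i ∈ Finset.range (j + 1), (Q m).coeff i * (c:ℂ) ^ i :=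
        Polynomial.eval_eq_sum_range' (hQd m hm) _
      have e4 : ∑ i ∈ Finset.range (j + 1), (Q m).coeff i * cc m r * (c:ℂ)^i =
        (∑ i ∈ Finset.range (j + 1), (Q m).coeff i * (c:ℂ) ^ i) * cc m r := by
        rw [Finset.sum_mul]; exact Finset.sum_congr rfl fun i _ => by ring
      rw [e4, ← e3]
      simp only [Q]
      rw [Polynomial.eval_mul, Polynomial.eval_C, Ev_eval _ _ h]
      push_cast
      ring
    rw [Finset.sum_congr rfl e2, Finset.sum_comm]
    refine Finset.sum_congr rfl fun i _ => ?_
    rw [hbv, Finset.sum_mul]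
  let B : (ℕ → ℂ) → Polynomial ℂ := fun d => ∑ i ∈ Finset.range (j + 1), Polynomial.C (d i) * Polynomial.X ^ i
  have hBe : ∀ d (c : ℂ), (B d).eval c = ∑ i ∈ Finset.range (j + 1), d i * c ^ i := by
    intro d c; simp [B, Polynomial.eval_finset_sum]
  -- parity
  have hpar : ∀ i < j + 1, ∀ r, b i (-r) = (-1)^i * b i r := by
    intro i hi r
    have : B (fun i => b i (-r)) = B (fun i => (-1)^i * b i r) := by
      refine poly_eq fun s c h => ?_
      rw [hBe, hBe, ← hb s c (-r) h]
      have e := hb (-s) (-c) r (by rw [neg_sq, neg_sq]; exact h)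
      rw [mul_neg, mul_neg, ← neg_mul, ← neg_mul] at e
      rw [e]
      refine Finset.sum_congr rfl fun i _ => ?_
      push_cast
      rw [neg_pow (c:ℂ)]; ring
    have h := congrArg (fun p => Polynomial.coeff p i) this
    simpa only [B, coeff_sum_CX _ _ _ hi] using h
  have hvan : ∀ i < j + 1, ∀ k < i, iteratedDeriv k (b i) 0 = 0 := by
    intro i hi k hk
    obtain ⟨P, hPd, hP⟩ := line_deriv_poly φ k
    have hder : ∀ s c : ℝ, s ^ 2 + c ^ 2 = 1 → iteratedDeriv k (fun r : ℝ => φ ![r * s, 0, r * c]) 0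
        = ∑ i ∈ Finset.range (j + 1), iteratedDeriv k (b i) 0 * (c:ℂ)^i := by
      intro s c h
      have : (fun r : ℝ => φ ![r * s, 0, r * c]) =
        fun r => ∑ i ∈ Finset.range (j + 1), (c:ℂ) ^ i * b i r := by
        funext r; rw [hb s c r h]; exact Finset.sum_congr rfl fun i _ => mul_comm _ _
      rw [this, iteratedDeriv_fun_sum]
      · refine Finset.sum_congr rfl fun i _ => ?_
        rw [iteratedDeriv_const_mul _ ((b i).smooth k).contDiffAt, mul_comm]
      · intro i _
        exact (contDiff_const.mul ((b i).smooth k)).contDiffAt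
    have : B (fun i => iteratedDeriv k (b i) 0) = P := by
      refine poly_eq fun s c h => ?_
      rw [hBe, hP s c h, hder s c h, hder (-s) c (by rw [neg_sq]; exact h)]
      ring
    have h := congrArg (fun p => Polynomial.coeff p i) this
    simp only [B, coeff_sum_CX _ _ _ hi] at h
    rw [h]
    exact Polynomial.coeff_eq_zero_of_natDegree_lt (by omega)
  have hex : ∀ i, ∃ a : 𝓢(ℝ, ℂ), i < j + 1 → ∀ r : ℝ, b i r = r^i * a (r^2) := by
    intro i
    by_cases hi : i < j + 1
    · obtain ⟨a, ha⟩ := schwartz_parity i (b i) (hpar i hi) (hvan i hi)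
      exact ⟨a, fun _ => ha⟩
    · exact ⟨0, fun h => absurd h hi⟩
  choose a ha using hex
  refine ⟨a, fun x => ?_⟩
  set r := √(x 0 ^ 2 + x 1 ^ 2 + x 2 ^ 2) with hr
  have hr2 : r ^ 2 = x 0 ^ 2 + x 1 ^ 2 + x 2 ^ 2 := Real.sq_sqrt (by positivity)
  have hρ : √(x 0 ^ 2 + x 1 ^ 2) ^ 2 = x 0 ^ 2 + x 1 ^ 2 := Real.sq_sqrt (by positivity)
  have hsc : ∃ s c : ℝ, s ^ 2 + c ^ 2 = 1 ∧ √(x 0 ^ 2 + x 1 ^ 2) = r * s ∧ x 2 = r * c := by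
    by_cases h0 : r = 0
    · refine ⟨0, 1, by norm_num, ?_, ?_⟩
      · rw [h0] at hr2
        have : √(x 0 ^ 2 + x 1 ^ 2) ^ 2 = 0 := by rw [hρ]; nlinarith [sq_nonneg (x 0), sq_nonneg (x 1), sq_nonneg (x 2)]
        simpa using this
      · rw [h0] at hr2
        have : x 2 ^ 2 = 0 := by nlinarith [sq_nonneg (x 0), sq_nonneg (x 1), sq_nonneg (x 2)]
        rw [h0, zero_mul]; simpa using this
    · refine ⟨√(x 0 ^ 2 + x 1 ^ 2) / r, x 2 / r, ?_, by field_simp, by field_simp⟩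
      rw [div_pow, div_pow, hρ, ← add_div, ← hr2, div_self (pow_ne_zero 2 h0)]
  obtain ⟨s, c, hs, e1, e2⟩ := hsc
  rw [h3, e1, e2, hb s c r hs]
  refine Finset.sum_congr rfl fun i hi => ?_
  rw [ha i (Finset.mem_range.1 hi), ← e2, ← hr2, e2]
  push_cast
  ring
end PartG

section PartH
open scoped ContDiff FourierTransform LineDeriv SchwartzMap

/-! K' invariance -/
lemma invK_eq {H : V3 × ℝ → ℂ} (hH : InvK' H) {x y : V3} (h1 : x 0^2 + x 1^2 = y 0^2 + y 1^2)
    (h2 : x 2 = y 2) (s : ℝ) : H (x, s) = H (y, s) := by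
  by_cases hr : y 0^2 + y 1^2 = 0
  · have : x = y := by
      funext i
      fin_cases i
      · change x 0 = y 0
        have : x 0 = 0 := by nlinarith [sq_nonneg (x 0), sq_nonneg (x 1)]
        have : y 0 = 0 := by nlinarith [sq_nonneg (y 0), sq_nonneg (y 1)]
        linarith
      · change x 1 = y 1
        have : x 1 = 0 := by nlinarith [sq_nonneg (x 0), sq_nonneg (x 1)]
        have : y 1 = 0 := by nlinarith [sq_nonneg (y 0), sq_nonneg (y 1)]
        linarith
      · exact h2
    rw [this]
  · set r := y 0^2 + y 1^2 with hrd
    set c := (y 0 * x 0 + y 1 * x 1)/r with hc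
    set d := (y 0 * x 1 - y 1 * x 0)/r with hd
    have hcd : c * c + d * d = 1 := by
      rw [hc, hd]; field_simp
      have : r ^ 2 = (x 0^2 + x 1^2) * (y 0^2 + y 1^2) := by rw [h1, ← hrd]; ring
      rw [this]; ring
    have hA : (!![c, -d; d, c] : Matrix (Fin 2) (Fin 2) ℝ) ∈ O2 := by
      change _ * _ = _
      ext i j
      fin_cases i <;> fin_cases j <;> simp [Matrix.mul_apply, Fin.sum_univ_two] <;> linarith
    have hdet : (!![c, -d; d, c] : Matrix (Fin 2) (Fin 2) ℝ).det = 1 := by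
      rw [Matrix.det_fin_two_of]; linarith
    have := hH _ hA (y, s)
    rw [← this]
    congr 1
    unfold KAct
    rw [hdet]
    refine Prod.ext ?_ (by simp)
    funext i
    fin_cases i
    · simp [hc, hd, Matrix.mulVec, dotProduct, Fin.sum_univ_two]
      field_simp; rw [hrd]; ring
    · simp [hc, hd, Matrix.mulVec, dotProduct, Fin.sum_univ_two]
      field_simp; rw [hrd]; ring
    · simp [h2]

lemma invK_flip {H : V3 × ℝ → ℂ} (hH : InvK' H) (x : V3) (s : ℝ) : H (![x 0, x 1, -x 2], -s) = H (x, s) := by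
  have hA : (!![1, 0; 0, -1] : Matrix (Fin 2) (Fin 2) ℝ) ∈ O2 := by
    change _ * _ = _
    ext i j
    fin_cases i <;> fin_cases j <;> simp [Matrix.mul_apply, Fin.sum_univ_two]
  rw [← hH _ hA (x, s)]
  have : KAct !![1, 0; 0, -1] (x, s) = (![x 0, -x 1, -x 2], -s) := by
    unfold KAct
    refine Prod.ext ?_ (by simp)
    funext i
    fin_cases i <;> simp [Matrix.mulVec, dotProduct, Fin.sum_univ_two]
  rw [this]
  apply invK_eq hH <;> simp

/-! weights -/
def wt (i : Fin 3) (F : 𝓢(V3 × V3, ℂ)) : 𝓢(V3 × V3, ℂ) :=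
  SchwartzMap.smulLeftCLM ℂ (fun p : V3 × V3 => ((ContinuousLinearMap.proj i).comp (ContinuousLinearMap.snd ℝ V3 V3) : V3 × V3 →L[ℝ] ℝ) p) F

lemma wt_apply (i : Fin 3) (F : 𝓢(V3 × V3, ℂ)) (p) : wt i F p = (p.2 i : ℂ) * F p := by
  rw [wt, SchwartzMap.smulLeftCLM_apply_apply (ContinuousLinearMap.hasTemperateGrowth _)]; simp

lemma wt_iter (i : Fin 3) (n : ℕ) (F : 𝓢(V3 × V3, ℂ)) (p) : ((wt i)^[n] F) p = (p.2 i : ℂ)^n * F p := by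
  induction n with
  | zero => simp
  | succ j ih => rw [Function.iterate_succ_apply', wt_apply, ih]; ring

def lineL : ℝ →L[ℝ] V3 := ContinuousLinearMap.pi ![0, 0, ContinuousLinearMap.id ℝ ℝ]
lemma lineL_apply (r : ℝ) : lineL r = ![0,0,r] := by
  funext i; fin_cases i <;> simp [lineL]

def rline (f : 𝓢(V3, ℂ)) : 𝓢(ℝ, ℂ) :=
  SchwartzMap.compCLMOfAntilipschitz ℂ (K := 1) (g := lineL) lineL.hasTemperateGrowth
    (by
      refine AntilipschitzWith.of_le_mul_dist fun x y => ?_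
      rw [NNReal.coe_one, one_mul]
      have := dist_le_pi_dist (lineL x) (lineL y) 2
      simpa [lineL_apply] using this) f
lemma rline_apply (f : 𝓢(V3, ℂ)) (r : ℝ) : rline f r = f ![0,0,r] := by
  rw [← lineL_apply]; rfl

lemma mom_rad (F : 𝓢(V3 × V3, ℂ)) (G : 𝓢(V3 × ℝ, ℂ)) (h : ∀ (x : V3) (t : ℝ), RadonT F x t = G (x, t))
    (j : ℕ) (x : V3) : mom j G x = ∫ y : V3, (y 2 : ℂ)^j * F (x, y) := by
  have hi := fiber_integrable volume ((wt 2)^[j] F) x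
  simp only [wt_iter] at hi
  rw [mom_apply, ← mp3.map_eq, integral_map mp3.measurable.aemeasurable]
  · have hi2 := (mp3.integrable_comp (g := fun y : V3 => (y 2 : ℂ)^j * F (x, y)) hi.1).2 hi
    refine Eq.trans ?_ (integral_prod _ hi2).symm
    refine integral_congr_ae ?_
    filter_upwards with t
    rw [← h, RadonT, mul_comm, ← integral_const_mul]
    rfl
  · rw [mp3.map_eq]; exact hi.1

lemma rotInv {F : V3 × V3 → ℂ} (hF : Inv3 F) {k : Mat3} (hk : k ∈ SO3) (j : ℕ) (x : V3) :
    ∫ y : V3, (y 2 : ℂ)^j * F (k *ᵥ x, y) = ∫ y : V3, ((k *ᵥ y) 2 : ℂ)^j * F (x, y) := by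
  rw [← (orth_mp hk.1).integral_comp (oL k hk.1).toHomeomorph.measurableEmbedding
    (fun y : V3 => (y 2 : ℂ)^j * F (k *ᵥ x, y))]
  simp only [hF k hk]

lemma rot_mem {s c : ℝ} (h : s^2 + c^2 = 1) : (!![c, 0, s; 0, 1, 0; -s, 0, c] : Mat3) ∈ SO3 := by
  constructor
  · ext i j
    fin_cases i <;> fin_cases j <;> simp [Matrix.mul_apply, Fin.sum_univ_three] <;> linarith
  · simp [Matrix.det_fin_three]; linarith

theorem forward (G : 𝓢(V3 × ℝ, ℂ)) (hG : InvK' G) (F : 𝓢(V3 × V3, ℂ)) (hF : Inv3 F)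
    (h : ∀ (x : V3) (t : ℝ), RadonT F x t = G (x, t)) (j : ℕ) :
    ∃ a : ℕ → 𝓢(ℝ, ℂ), ∀ x : V3, mom j G x = ∑ i ∈ Finset.range (j+1), a i (x 0^2+x 1^2+x 2^2) * (x 2 : ℂ)^i := by
  refine forward_core (mom j G) j (fun m => rline (pint volume ((wt 0)^[j-m] ((wt 2)^[m] F)))) ?_ ?_ ?_
  · intro s c r hsc
    have hk := rot_mem hsc
    have e : (![r*s, 0, r*c] : V3) = (!![c, 0, s; 0, 1, 0; -s, 0, c] : Mat3) *ᵥ ![0,0,r] := by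
      funext i; fin_cases i <;> simp [Matrix.mulVec, dotProduct, Fin.sum_univ_three, mul_comm]
    rw [mom_rad F G h, e, rotInv hF hk]
    have hb : ∀ y : V3, (((!![c, 0, s; 0, 1, 0; -s, 0, c] : Mat3) *ᵥ y) 2 : ℂ)^j * F (![0,0,r], y) =
      ∑ m ∈ Finset.range (j+1), (j.choose m : ℂ) * ((c:ℂ)^m * (-(s:ℂ))^(j-m)) *
        ((wt 0)^[j-m] ((wt 2)^[m] F)) (![0,0,r], y) := by
      intro y
      have : (((!![c, 0, s; 0, 1, 0; -s, 0, c] : Mat3) *ᵥ y) 2 : ℂ) = (c:ℂ) * y 2 + (-(s:ℂ)) * y 0 := by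
        simp [Matrix.mulVec, dotProduct, Fin.sum_univ_three]; ring
      rw [this, add_pow, Finset.sum_mul]
      refine Finset.sum_congr rfl fun m _ => ?_
      rw [wt_iter, wt_iter]; simp only [mul_pow]; ring
    simp only [hb]
    rw [integral_finsetSum]
    · refine Finset.sum_congr rfl fun m _ => ?_
      rw [integral_const_mul, rline_apply, pint_apply]
    · intro m _
      exact (fiber_integrable volume _ _).const_mul _
  · intro x z
    simp only [mom_apply]
    congr 1; funext t
    rw [invK_eq hG (x := ![-x, 0, z]) (y := ![x, 0, z])] <;> simp
  · intro x
    simp only [mom_apply]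
    congr 1; funext t
    rw [invK_eq hG (x := x) (y := ![√(x 0^2+x 1^2), 0, x 2])]
    · simp; rw [Real.sq_sqrt (by positivity)]
    · simp
end PartH

section PartI
open scoped ContDiff FourierTransform LineDeriv SchwartzMap

lemma FT4_invK {G : 𝓢(V3 × ℝ, ℂ)} (hG : InvK' G) : InvK' (FT4 G) := by
  intro A hA p
  have hA' : A * Aᵀ = 1 := hA
  have hdd : A.det * A.det = 1 := by
    have := congrArg Matrix.det hA'
    rwa [det_mul, det_transpose, det_one] at this
  have hd0 : A.det ≠ 0 := by intro h; rw [h] at hdd; simp at hdd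
  have e00 := congrFun (congrFun hA' 0) 0
  have e01 := congrFun (congrFun hA' 0) 1
  have e11 := congrFun (congrFun hA' 1) 1
  simp [Matrix.mul_apply, Fin.sum_univ_two] at e00 e01 e11
  set B : Mat3 := !![A 0 0, A 0 1, 0; A 1 0, A 1 1, 0; 0, 0, A.det] with hBd
  have hB : B * B.transpose = 1 := by
    ext i j
    fin_cases i <;> fin_cases j <;> simp [hBd, Matrix.mul_apply, Fin.sum_univ_three] <;> linarith
  let T : (V3 × ℝ) ≃L[ℝ] (V3 × ℝ) :=
    (oL B hB).prodCongr (ContinuousLinearEquiv.unitsEquivAut ℝ (Units.mk0 A.det hd0))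
  have hT : ∀ p, T p = KAct A p := by
    intro p
    refine Prod.ext ?_ ?_
    · change B *ᵥ p.1 = _
      funext i
      fin_cases i <;> simp [hBd, KAct, Matrix.mulVec, dotProduct, Fin.sum_univ_three, Fin.sum_univ_two]
    · change p.2 * A.det = A.det * p.2
      ring
  have hc := FTg_comp e4 T (by
    intro x y
    rw [e4_inner, e4_inner]
    have h1 : ∀ x, (T x).1 = B *ᵥ x.1 := fun _ => rfl
    have h2 : ∀ x, (T x).2 = x.2 * A.det := fun _ => rfl
    rw [h1, h1, h2, h2, orth_dot hB]
    linear_combination (x.2 * y.2) * hdd) G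
  have hG' : SchwartzMap.compCLMOfContinuousLinearEquiv ℂ T G = G := by
    ext p
    change G (T p) = G p
    rw [hT, hG A hA]
  rw [hG'] at hc
  rw [← hT]
  exact (DFunLike.congr_fun hc p).symm

/-! tensor products -/
lemma tensor_decay {X Y : Type} [NormedAddCommGroup X] [NormedSpace ℝ X] [NormedAddCommGroup Y] [NormedSpace ℝ Y]
    (f : 𝓢(X, ℂ)) (g : 𝓢(Y, ℂ)) (k n : ℕ) : ∃ C, ∀ p : X × Y,
      ‖p‖^k * ‖iteratedFDeriv ℝ n (fun p : X × Y => f p.1 * g p.2) p‖ ≤ C := by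
  choose A hA0 hA using fun i => schwartz_bound1 f k i
  choose B hB0 hB using fun i => schwartz_bound1 g k i
  refine ⟨∑ i ∈ Finset.range (n+1), (n.choose i : ℝ) * A i * B (n-i), fun p => ?_⟩
  have hf : ContDiff ℝ ∞ (fun p : X × Y => f p.1) := (f.smooth ⊤).comp contDiff_fst
  have hg : ContDiff ℝ ∞ (fun p : X × Y => g p.2) := (g.smooth ⊤).comp contDiff_snd
  have h := norm_iteratedFDeriv_mul_le hf hg p (n := n) (by exact_mod_cast le_top)
  have h1 : ∀ i, ‖iteratedFDeriv ℝ i (fun p : X × Y => f p.1) p‖ ≤ ‖iteratedFDeriv ℝ i f p.1‖ := by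
    intro i
    have := (ContinuousLinearMap.fst ℝ X Y).iteratedFDeriv_comp_right (f.smooth ⊤) p (i := i) (by exact_mod_cast le_top)
    change ‖iteratedFDeriv ℝ i (f ∘ (ContinuousLinearMap.fst ℝ X Y)) p‖ ≤ _
    rw [this]
    refine (ContinuousMultilinearMap.norm_compContinuousLinearMap_le _ _).trans ?_
    refine mul_le_of_le_one_right (norm_nonneg _) ?_
    refine Finset.prod_le_one (fun _ _ => norm_nonneg _) fun _ _ => ContinuousLinearMap.norm_fst_le ℝ X Y
  have h2 : ∀ i, ‖iteratedFDeriv ℝ i (fun p : X × Y => g p.2) p‖ ≤ ‖iteratedFDeriv ℝ i g p.2‖ := by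
    intro i
    have := (ContinuousLinearMap.snd ℝ X Y).iteratedFDeriv_comp_right (g.smooth ⊤) p (i := i) (by exact_mod_cast le_top)
    change ‖iteratedFDeriv ℝ i (g ∘ (ContinuousLinearMap.snd ℝ X Y)) p‖ ≤ _
    rw [this]
    refine (ContinuousMultilinearMap.norm_compContinuousLinearMap_le _ _).trans ?_
    refine mul_le_of_le_one_right (norm_nonneg _) ?_
    refine Finset.prod_le_one (fun _ _ => norm_nonneg _) fun _ _ => ContinuousLinearMap.norm_snd_le ℝ X Y
  have hp : ‖p‖^k ≤ (1+‖p.1‖)^k * (1+‖p.2‖)^k := by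
    rw [← mul_pow]
    refine pow_le_pow_left₀ (norm_nonneg _) ?_ k
    rw [Prod.norm_def]
    have := norm_nonneg p.1
    have := norm_nonneg p.2
    refine max_le ?_ ?_ <;> nlinarith
  calc _ ≤ ((1+‖p.1‖)^k * (1+‖p.2‖)^k) * ∑ i ∈ Finset.range (n + 1),
      (n.choose i : ℝ) * ‖iteratedFDeriv ℝ i f p.1‖ * ‖iteratedFDeriv ℝ (n - i) g p.2‖ := by
        refine mul_le_mul hp (h.trans ?_) (norm_nonneg _) (by positivity)
        refine Finset.sum_le_sum fun i _ => ?_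
        gcongr
        · exact h1 i
        · exact h2 _
    _ ≤ _ := by
        rw [Finset.mul_sum]
        refine Finset.sum_le_sum fun i _ => ?_
        have a := hA i p.1
        have b := hB (n-i) p.2
        calc _ = (n.choose i : ℝ) * ((1+‖p.1‖)^k * ‖iteratedFDeriv ℝ i f p.1‖) * ((1+‖p.2‖)^k * ‖iteratedFDeriv ℝ (n - i) g p.2‖) := by ring
          _ ≤ _ := by
            have := hA0 i
            gcongr

def tens {X Y : Type} [NormedAddCommGroup X] [NormedSpace ℝ X] [NormedAddCommGroup Y] [NormedSpace ℝ Y]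
    (f : 𝓢(X, ℂ)) (g : 𝓢(Y, ℂ)) : 𝓢(X × Y, ℂ) where
  toFun := fun p => f p.1 * g p.2
  smooth' := ((f.smooth ⊤).comp contDiff_fst).mul ((g.smooth ⊤).comp contDiff_snd)
  decay' := tensor_decay f g

lemma tens_apply {X Y : Type} [NormedAddCommGroup X] [NormedSpace ℝ X] [NormedAddCommGroup Y] [NormedSpace ℝ Y]
    (f : 𝓢(X, ℂ)) (g : 𝓢(Y, ℂ)) (p) : tens f g p = f p.1 * g p.2 := rfl

/-! cutoff -/
lemma le_norm3 (x : V3) : ‖x‖^2 ≤ x ⬝ᵥ x := by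
  have h : ‖x‖ ≤ √(x ⬝ᵥ x) := by
    refine (pi_norm_le_iff_of_nonneg (Real.sqrt_nonneg _)).2 fun i => ?_
    rw [Real.norm_eq_abs]
    apply Real.abs_le_sqrt
    simp only [dotProduct, Fin.sum_univ_three]
    fin_cases i <;> simp <;> nlinarith [sq_nonneg (x 0), sq_nonneg (x 1), sq_nonneg (x 2)]
  have h0 : 0 ≤ x ⬝ᵥ x := by simp only [dotProduct, Fin.sum_univ_three]; nlinarith [sq_nonneg (x 0), sq_nonneg (x 1), sq_nonneg (x 2)]
  calc _ ≤ (√(x ⬝ᵥ x))^2 := by gcongr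
    _ = _ := Real.sq_sqrt h0

lemma dot_le3 (x : V3) : x ⬝ᵥ x ≤ 3 * ‖x‖^2 := by
  have h : ∀ i, x i * x i ≤ ‖x‖^2 := fun i => by
    have := norm_le_pi_norm x i
    rw [← abs_mul_abs_self, sq]
    exact mul_le_mul this this (abs_nonneg _) (norm_nonneg _)
  simp only [dotProduct, Fin.sum_univ_three]
  linarith [h 0, h 1, h 2]

lemma contDiff_dot {E : Type} [NormedAddCommGroup E] [NormedSpace ℝ E] {n} {f g : E → V3} (hf : ContDiff ℝ n f) (hg : ContDiff ℝ n g) :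
    ContDiff ℝ n (fun x => f x ⬝ᵥ g x) := by
  simp only [dotProduct]
  exact ContDiff.sum fun i _ => (contDiff_pi.1 hf i).mul (contDiff_pi.1 hg i)

def chi : 𝓢(V3, ℂ) :=
  HasCompactSupport.toSchwartzMap (f := fun η : V3 => (Real.smoothTransition (2 - η ⬝ᵥ η) : ℂ))
    (by
      refine HasCompactSupport.intro (isCompact_closedBall (0:V3) 2) fun x hx => ?_
      rw [mem_closedBall_zero_iff, not_le] at hx
      rw [Real.smoothTransition.zero_of_nonpos]; · simp
      have := le_norm3 x
      nlinarith)
    (by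
      refine Complex.ofRealCLM.contDiff.comp (Real.smoothTransition.contDiff.comp ?_)
      exact contDiff_const.sub (contDiff_dot contDiff_id contDiff_id))

lemma chi_apply (η : V3) : chi η = (Real.smoothTransition (2 - η ⬝ᵥ η) : ℂ) := rfl
lemma chi_one {η : V3} (h : η ⬝ᵥ η ≤ 1) : chi η = 1 := by
  rw [chi_apply, Real.smoothTransition.one_of_one_le (by linarith)]; simp

/-! radial functions -/
lemma dot_temp : (fun x : V3 => x ⬝ᵥ x).HasTemperateGrowth := by
  simp only [dotProduct]
  refine Function.HasTemperateGrowth.sum fun i _ => ?_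
  exact ((ContinuousLinearMap.proj i : V3 →L[ℝ] ℝ).hasTemperateGrowth).mul ((ContinuousLinearMap.proj i : V3 →L[ℝ] ℝ).hasTemperateGrowth)

def radl (a : 𝓢(ℝ, ℂ)) : 𝓢(V3, ℂ) :=
  SchwartzMap.compCLM ℂ dot_temp (by
    refine ⟨1, 1, fun x => ?_⟩
    have := le_norm3 x
    rw [Real.norm_eq_abs]
    have := le_abs_self (x ⬝ᵥ x)
    nlinarith [sq_nonneg (‖x‖ - 1)]) a
lemma radl_apply (a : 𝓢(ℝ, ℂ)) (x : V3) : radl a x = a (x ⬝ᵥ x) := rfl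
end PartI

section PartJ
open scoped ContDiff FourierTransform LineDeriv SchwartzMap

lemma FT3_add (f g : 𝓢(V3, ℂ)) : FT3 (f + g) = FT3 f + FT3 g := by
  simp only [FTg, map_add, FourierTransform.fourier_add]
lemma FT3_smul (c : ℂ) (f : 𝓢(V3, ℂ)) : FT3 (c • f) = c • FT3 f := by
  simp only [FTg, map_smul, FourierTransform.fourier_smul]
def FT3l : 𝓢(V3, ℂ) →ₗ[ℂ] 𝓢(V3, ℂ) where
  toFun := FT3
  map_add' := FT3_add
  map_smul' := FT3_smul
lemma FT3l_apply (f : 𝓢(V3, ℂ)) : FT3l f = FT3 f := rfl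

def dmi (η : V3) (i : ℕ) (f : 𝓢(V3, ℂ)) : 𝓢(V3, ℂ) :=
  SchwartzMap.smulLeftCLM ℂ (fun x : V3 => (x ⬝ᵥ η)^i) f
lemma dmi_apply (η : V3) (i : ℕ) (f : 𝓢(V3, ℂ)) (x : V3) : dmi η i f x = ((x ⬝ᵥ η : ℝ) : ℂ)^i * f x := by
  have h : (fun x : V3 => x ⬝ᵥ η).HasTemperateGrowth := by
    simp only [dotProduct]
    refine Function.HasTemperateGrowth.sum fun i _ => ?_
    exact ((ContinuousLinearMap.proj i : V3 →L[ℝ] ℝ).hasTemperateGrowth).mul (Function.HasTemperateGrowth.const _)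
  have h' : (fun x : V3 => (x ⬝ᵥ η)^i).HasTemperateGrowth := h.pow i
  rw [dmi, SchwartzMap.smulLeftCLM_apply_apply h']; simp

def xm (l : Fin 3) (f : 𝓢(V3, ℂ)) : 𝓢(V3, ℂ) := dmi (Pi.single l 1) 1 f
lemma xm_apply (l : Fin 3) (f : 𝓢(V3, ℂ)) (x : V3) : xm l f x = (x l : ℂ) * f x := by
  rw [xm, dmi_apply]; simp

def TT : ℕ → 𝓢(V3, ℂ) → 𝓢(V3 × V3, ℂ)
  | 0, f => tens (FT3 f) chi
  | i+1, f => wt 0 (TT i (xm 0 f)) + wt 1 (TT i (xm 1 f)) + wt 2 (TT i (xm 2 f))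

lemma TT_apply (i : ℕ) : ∀ (f : 𝓢(V3, ℂ)) (ξ η : V3), TT i f (ξ, η) = chi η * FT3 (dmi η i f) ξ := by
  induction i with
  | zero =>
    intro f ξ η
    have : dmi η 0 f = f := by ext x; rw [dmi_apply]; simp
    rw [this, TT, tens_apply, mul_comm]
  | succ i ih =>
    intro f ξ η
    have : dmi η (i+1) f = (η 0 : ℂ) • dmi η i (xm 0 f) + (η 1 : ℂ) • dmi η i (xm 1 f) + (η 2 : ℂ) • dmi η i (xm 2 f) := by
      ext x
      simp only [_root_.add_apply, _root_.smul_apply, dmi_apply, xm_apply, smul_eq_mul, pow_succ]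
      simp only [dotProduct, Fin.sum_univ_three]
      push_cast
      ring
    rw [this, ← FT3l_apply, map_add, map_add, map_smul, map_smul, map_smul, TT]
    simp only [_root_.add_apply, _root_.smul_apply, wt_apply, ih, FT3l_apply, smul_eq_mul]
    ring

lemma TT_orth {A : Mat3} (h : A * A.transpose = 1) (i : ℕ) (f : 𝓢(V3, ℂ)) (hf : ∀ x, f (A *ᵥ x) = f x) (ξ η : V3) :
    TT i f (A *ᵥ ξ, A *ᵥ η) = TT i f (ξ, η) := by
  rw [TT_apply, TT_apply, chi_apply, chi_apply, orth_dot h]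
  congr 1
  have h1 := DFunLike.congr_fun (FT3_orth h (dmi (A *ᵥ η) i f)) ξ
  have h2 : SchwartzMap.compCLMOfContinuousLinearEquiv ℂ (oL A h) (dmi (A *ᵥ η) i f) = dmi η i f := by
    ext x
    change dmi (A *ᵥ η) i f (A *ᵥ x) = _
    rw [dmi_apply, dmi_apply, orth_dot h, hf]
  rw [h2] at h1
  exact h1.symm

def wq (f : 𝓢(V3 × V3, ℂ)) : 𝓢(V3 × V3, ℂ) := wt 0 (wt 0 f) + wt 1 (wt 1 f) + wt 2 (wt 2 f)
lemma wq_apply (f : 𝓢(V3 × V3, ℂ)) (p) : wq f p = ((p.2 ⬝ᵥ p.2 : ℝ) : ℂ) * f p := by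
  simp only [wq, _root_.add_apply, wt_apply]
  simp only [dotProduct, Fin.sum_univ_three]
  push_cast; ring
lemma wq_iter (n : ℕ) (f : 𝓢(V3 × V3, ℂ)) (p) : (wq^[n] f) p = ((p.2 ⬝ᵥ p.2 : ℝ) : ℂ)^n * f p := by
  induction n with
  | zero => simp
  | succ j ih => rw [Function.iterate_succ_apply', wq_apply, ih]; ring

def PP (j : ℕ) (a : ℕ → 𝓢(ℝ, ℂ)) : 𝓢(V3 × V3, ℂ) :=
  ((-(2 * Real.pi * I))^j / (j.factorial : ℂ)) •
    ∑ i ∈ Finset.range (j+1), if Even (j-i) then wq^[(j-i)/2] (TT i (radl (a i))) else 0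

lemma PP_apply (j : ℕ) (a : ℕ → 𝓢(ℝ, ℂ)) (p) : PP j a p = ((-(2 * Real.pi * I))^j / (j.factorial : ℂ)) *
    ∑ i ∈ Finset.range (j+1), if Even (j-i) then ((p.2 ⬝ᵥ p.2 : ℝ) : ℂ)^((j-i)/2) * TT i (radl (a i)) p else 0 := by
  rw [PP, _root_.smul_apply, _root_.sum_apply, smul_eq_mul]
  congr 1
  refine Finset.sum_congr rfl fun i _ => ?_
  split_ifs
  · rw [wq_iter]
  · rfl

lemma PP_orth (j : ℕ) (a : ℕ → 𝓢(ℝ, ℂ)) {A : Mat3} (h : A * A.transpose = 1) (ξ η : V3) :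
    PP j a (A *ᵥ ξ, A *ᵥ η) = PP j a (ξ, η) := by
  rw [PP_apply, PP_apply]
  congr 1
  refine Finset.sum_congr rfl fun i _ => ?_
  simp only [orth_dot h]
  rw [TT_orth h]
  intro x; rw [radl_apply, radl_apply, orth_dot h]

lemma PP_line (j : ℕ) (a : ℕ → 𝓢(ℝ, ℂ)) (φ : 𝓢(V3, ℂ))
    (hφ : ∀ x, φ x = ∑ i ∈ Finset.range (j+1), if Even (j-i) then a i (x ⬝ᵥ x) * (x 2 : ℂ)^i else 0)
    (ξ : V3) (s : ℝ) : PP j a (ξ, ![0,0,s]) = chi ![0,0,s] * ((s:ℂ)^j * (((-(2 * Real.pi * I))^j / (j.factorial : ℂ)) * FT3 φ ξ)) := by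
  have hs : (s:ℂ)^j • φ = ∑ i ∈ Finset.range (j+1),
      if Even (j-i) then (((![0,0,s] : V3) ⬝ᵥ (![0,0,s] : V3) : ℝ) : ℂ)^((j-i)/2) • dmi ![0,0,s] i (radl (a i)) else 0 := by
    ext x
    rw [_root_.smul_apply, hφ, _root_.sum_apply, Finset.smul_sum]
    refine Finset.sum_congr rfl fun i hi => ?_
    rw [Finset.mem_range] at hi
    split_ifs with he
    · obtain ⟨m, hm⟩ := he
      have : (j-i)/2 = m := by omega
      rw [this, _root_.smul_apply, dmi_apply, radl_apply]
      have e : j = m + m + i := by omega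
      simp only [dotProduct, Fin.sum_univ_three, smul_eq_mul]
      rw [e]
      simp
      ring
    · simp
  have h2 := congrArg (fun f => FT3l f ξ) hs
  simp only [map_smul, map_sum, _root_.smul_apply, _root_.sum_apply, smul_eq_mul, FT3l_apply] at h2
  have e : ∀ c d e : ℂ, c * (d * e) = d * (c * e) := fun c d e => by ring
  rw [PP_apply, e _ _ (FT3 φ ξ), h2, e (chi _)]
  congr 1
  rw [Finset.mul_sum]
  refine Finset.sum_congr rfl fun i hi => ?_
  split_ifs with he
  · rw [TT_apply, ← FT3l_apply, ← FT3l_apply, map_smul, _root_.smul_apply, smul_eq_mul]; ring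
  · rw [← FT3l_apply, map_zero]; simp

lemma parity_mom (G : 𝓢(V3 × ℝ, ℂ)) (hG : InvK' G) (j : ℕ) (a : ℕ → 𝓢(ℝ, ℂ))
    (h : ∀ x : V3, mom j G x = ∑ i ∈ Finset.range (j+1), a i (x ⬝ᵥ x) * (x 2 : ℂ)^i) (x : V3) :
    mom j G x = ∑ i ∈ Finset.range (j+1), if Even (j-i) then a i (x ⬝ᵥ x) * (x 2 : ℂ)^i else 0 := by
  have h1 : mom j G ![x 0, x 1, - x 2] = (-1)^j * mom j G x := by
    rw [mom_apply, mom_apply, ← integral_neg_eq_self, ← integral_const_mul]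
    congr 1; funext t
    rw [invK_flip hG]
    push_cast; rw [neg_pow]; ring
  have h2 := h ![x 0, x 1, - x 2]
  have e : (![x 0, x 1, - x 2] : V3) ⬝ᵥ (![x 0, x 1, - x 2] : V3) = x ⬝ᵥ x := by
    simp [dotProduct, Fin.sum_univ_three]
  rw [h1, e] at h2
  have h3 : mom j G x = (1/2) * (mom j G x + (-1)^j * ((-1)^j * mom j G x)) := by
    rw [← mul_assoc, ← mul_pow]; norm_num; ring
  rw [h3, h2]
  nth_rewrite 1 [h x]
  rw [Finset.mul_sum, ← Finset.sum_add_distrib, Finset.mul_sum]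
  refine Finset.sum_congr rfl fun i hi => ?_
  rw [Finset.mem_range] at hi
  obtain ⟨m, rfl⟩ : ∃ m, j = i + m := ⟨j - i, by omega⟩
  have e1 : i + m - i = m := by omega
  have e2 : (-1:ℂ)^(i+m) * (a i (x ⬝ᵥ x) * ((-x 2 : ℝ) : ℂ)^i) = (-1)^m * (a i (x ⬝ᵥ x) * (x 2 : ℂ)^i) := by
    push_cast; rw [neg_pow (x 2 : ℂ), pow_add]
    have : (-1:ℂ)^i * (-1)^i = 1 := by rw [← mul_pow]; norm_num
    linear_combination ((-1)^m * (a i (x ⬝ᵥ x) * (x 2 : ℂ)^i)) * this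
  rw [e1]
  have e3 : (![x 0, x 1, - x 2] : V3) 2 = - x 2 := rfl
  rw [e3, e2]
  split_ifs with hm
  · rw [hm.neg_one_pow]; ring
  · rw [(Nat.not_even_iff_odd.1 hm).neg_one_pow]; ring
end PartJ

section PartK
open scoped ContDiff FourierTransform LineDeriv SchwartzMap

def resL : (V3 × ℝ) →L[ℝ] (V3 × V3) := (ContinuousLinearMap.id ℝ V3).prodMap lineL
lemma resL_apply (p : V3 × ℝ) : resL p = (p.1, ![0,0,p.2]) := by
  rw [← lineL_apply]; rfl

def res (f : 𝓢(V3 × V3, ℂ)) : 𝓢(V3 × ℝ, ℂ) :=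
  SchwartzMap.compCLMOfAntilipschitz ℂ (K := 1) (g := resL) resL.hasTemperateGrowth
    (by
      refine AntilipschitzWith.of_le_mul_dist fun x y => ?_
      rw [NNReal.coe_one, one_mul]
      rw [Prod.dist_eq, Prod.dist_eq]
      refine max_le_max (by simp [resL_apply]) ?_
      have := dist_le_pi_dist (resL x).2 (resL y).2 2
      simpa [resL_apply] using this) f
lemma res_apply (f : 𝓢(V3 × V3, ℂ)) (x : V3) (s : ℝ) : res f (x, s) = f (x, ![0,0,s]) := by
  change f (resL (x, s)) = _
  rw [resL_apply]

lemma ipow (l : ℕ) : ∀ (j : ℕ) (c : ℂ), iteratedDeriv l (fun s : ℝ => (s:ℂ)^j * c) 0 = if l = j then (j.factorial : ℂ) * c else 0 := by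
  induction l with
  | zero =>
    intro j c
    rw [iteratedDeriv_zero]
    rcases j with _ | j <;> simp
  | succ l ih =>
    intro j c
    rw [iteratedDeriv_succ']
    have : deriv (fun s : ℝ => (s:ℂ)^j * c) = fun s : ℝ => (s:ℂ)^(j-1) * (j * c) := by
      funext s
      have h := (((hasDerivAt_id s).ofReal_comp).pow j).mul_const c
      refine (h.deriv).trans ?_
      simp; ring
    rw [this, ih]
    rcases j with _ | j
    · simp
    · simp [Nat.factorial_succ]; split_ifs <;> ring

def RN (N : ℕ) (a : ℕ → ℕ → 𝓢(ℝ, ℂ)) (G : 𝓢(V3 × ℝ, ℂ)) : 𝓢(V3 × ℝ, ℂ) :=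
  FT4 G - ∑ j ∈ Finset.range N, res (PP j (a j))

lemma RN_apply (N : ℕ) (a : ℕ → ℕ → 𝓢(ℝ, ℂ)) (G : 𝓢(V3 × ℝ, ℂ)) (x : V3) (s : ℝ) :
    RN N a G (x, s) = FT4 G (x, s) - ∑ j ∈ Finset.range N, PP j (a j) (x, ![0,0,s]) := by
  rw [RN, _root_.sub_apply, _root_.sum_apply]
  simp only [res_apply]

lemma RN_van (N : ℕ) (a : ℕ → ℕ → 𝓢(ℝ, ℂ)) (G : 𝓢(V3 × ℝ, ℂ))
    (h : ∀ j x, mom j G x = ∑ i ∈ Finset.range (j+1), if Even (j-i) then a j i (x ⬝ᵥ x) * (x 2 : ℂ)^i else 0) :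
    Van N (RN N a G) := by
  intro l hl x
  rw [ds_iter]
  have hev : (fun s => RN N a G (x, s)) =ᶠ[nhds 0]
     ((fun s : ℝ => FT4 G (x, s)) - fun s : ℝ => ∑ j ∈ Finset.range N, (s:ℂ)^j * (((-(2 * Real.pi * I))^j / (j.factorial : ℂ)) * FT3 (mom j G) x)) := by
    have : Metric.ball (0:ℝ) 1 ∈ nhds (0:ℝ) := Metric.ball_mem_nhds _ one_pos
    filter_upwards [this] with s hs
    rw [RN_apply, Pi.sub_apply]
    congr 1
    refine Finset.sum_congr rfl fun j _ => ?_
    rw [PP_line j (a j) (mom j G) (h j), chi_one, one_mul]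
    rw [mem_ball_zero_iff, Real.norm_eq_abs] at hs
    simp [dotProduct, Fin.sum_univ_three]
    have := abs_lt.1 hs
    nlinarith
  rw [hev.iteratedDeriv_eq, iteratedDeriv_sub, iteratedDeriv_fun_sum]
  · simp only [ipow]
    rw [Finset.sum_ite_eq, if_pos (Finset.mem_range.2 hl), ← ds_iter, ds_FT4_zero]
    have : (l.factorial : ℂ) ≠ 0 := by exact_mod_cast l.factorial_ne_zero
    field_simp
    ring
  · intro j _
    exact (((Complex.ofRealCLM.contDiff.pow j).mul contDiff_const)).contDiffAt
  · exact ((FT4 G).smooth l |>.comp (contDiff_const.prodMk contDiff_id)).contDiffAt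
  · exact (ContDiff.sum fun j _ => ((Complex.ofRealCLM.contDiff.pow j).mul contDiff_const)).contDiffAt
end PartK

section PartL
open scoped ContDiff FourierTransform LineDeriv SchwartzMap

lemma ext_lemma {E1 E2 : Type} [NormedAddCommGroup E1] [NormedSpace ℝ E1] [NormedAddCommGroup E2] [NormedSpace ℝ E2] (n : ℕ) :
    ∀ {F : Type} [NormedAddCommGroup F] [NormedSpace ℝ F] (u : E1 × E2 → F)
    (_ : ∀ p, p.2 ≠ 0 → ContDiffAt ℝ ∞ u p) (_ : ∀ p, p.2 = 0 → u p = 0)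
    (_ : ∀ i ≤ n, ∃ C, 0 ≤ C ∧ ∀ p, p.2 ≠ 0 → ‖iteratedFDeriv ℝ i u p‖ ≤ C * ‖p.2‖^2),
    ContDiff ℝ n u ∧ ∀ i ≤ n, ∀ p, p.2 = 0 → iteratedFDeriv ℝ i u p = 0 := by
  induction n with
  | zero =>
    intro F _ _ u h1 h2 h3
    obtain ⟨C, hC0, hC⟩ := h3 0 le_rfl
    refine ⟨?_, ?_⟩
    · rw [Nat.cast_zero, contDiff_zero, continuous_iff_continuousAt]
      intro p
      by_cases hp : p.2 = 0
      · have hb : ∀ q, ‖u q‖ ≤ C * ‖q.2‖^2 := by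
          intro q
          by_cases hq : q.2 = 0
          · rw [h2 q hq]; simp; positivity
          · simpa using hC q hq
        rw [ContinuousAt, h2 p hp]
        refine squeeze_zero_norm hb ?_
        have : ContinuousAt (fun q : E1 × E2 => C * ‖q.2‖^2) p := by fun_prop
        simpa [ContinuousAt, hp] using this
      · exact (h1 p hp).continuousAt
    · intro i hi p hp
      obtain rfl : i = 0 := by omega
      ext; simp [h2 p hp]
  | succ n ih =>
    intro F _ _ u h1 h2 h3
    obtain ⟨C, hC0, hC⟩ := h3 0 (by omega)
    have hb : ∀ q, ‖u q‖ ≤ C * ‖q.2‖^2 := by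
      intro q
      by_cases hq : q.2 = 0
      · rw [h2 q hq]; simp; positivity
      · simpa using hC q hq
    have hd : ∀ p : E1 × E2, p.2 = 0 → HasFDerivAt u (0 : E1 × E2 →L[ℝ] F) p := by
      intro p hp
      rw [hasFDerivAt_iff_isLittleO]
      have : (fun q => u q - u p - (0 : E1 × E2 →L[ℝ] F) (q - p)) =O[nhds p] fun q => ‖q - p‖^2 := by
        refine Asymptotics.IsBigO.of_bound C (Filter.Eventually.of_forall fun q => ?_)
        rw [h2 p hp]; simp only [sub_zero, _root_.zero_apply]
        refine (hb q).trans ?_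
        have : ‖q.2‖ ≤ ‖q - p‖ := by
          have := norm_snd_le (q - p)
          rwa [Prod.snd_sub, hp, sub_zero] at this
        rw [norm_pow, norm_norm]
        gcongr
      refine this.trans_isLittleO ?_
      have h := Asymptotics.isLittleO_norm_pow_id (E' := E1 × E2) (n := 2) (by norm_num)
      exact h.comp_tendsto (tendsto_sub_nhds_zero_iff.2 Filter.tendsto_id)
    have hdiff : Differentiable ℝ u := by
      intro p
      by_cases hp : p.2 = 0
      · exact (hd p hp).differentiableAt
      · exact (h1 p hp).differentiableAt (by simp)
    obtain ⟨i1, i2⟩ := ih (fderiv ℝ u) (fun p hp => (h1 p hp).fderiv_right (by simp)) (fun p hp => (hd p hp).fderiv)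
      (by
        intro i hi
        obtain ⟨C, hC0, hC⟩ := h3 (i+1) (by omega)
        refine ⟨C, hC0, fun p hp => ?_⟩
        rw [norm_iteratedFDeriv_fderiv]; exact hC p hp)
    refine ⟨?_, ?_⟩
    · rw [Nat.cast_succ, contDiff_succ_iff_fderiv]
      exact ⟨hdiff, by simp, i1⟩
    · intro i hi p hp
      rcases i with _ | i
      · ext; simp [h2 p hp]
      · rw [← norm_eq_zero, ← norm_iteratedFDeriv_fderiv, i2 i (by omega) p hp, norm_zero]

/-! the map f -/
def rho (η : V3) : ℝ := √(η ⬝ᵥ η)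

def fy (p : V3 × V3) : V3 :=
  ![p.1 0 - p.2 0 * (p.1 ⬝ᵥ p.2 + rho p.2 * p.1 2) / (rho p.2 * (rho p.2 + p.2 2)),
    p.1 1 - p.2 1 * (p.1 ⬝ᵥ p.2 + rho p.2 * p.1 2) / (rho p.2 * (rho p.2 + p.2 2)),
    p.1 ⬝ᵥ p.2 / rho p.2]

def ff (p : V3 × V3) : V3 × ℝ := (fy p, rho p.2)

lemma dot_self_pos {η : V3} (h : η ≠ 0) : 0 < η ⬝ᵥ η := by
  have := le_norm3 η
  have : 0 < ‖η‖ := norm_pos_iff.2 h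
  nlinarith

lemma rho_pos {η : V3} (h : η ≠ 0) : 0 < rho η := Real.sqrt_pos.2 (dot_self_pos h)
lemma rho_sq (η : V3) : rho η ^2 = η ⬝ᵥ η := Real.sq_sqrt (by
  simp only [dotProduct, Fin.sum_univ_three]; nlinarith [sq_nonneg (η 0), sq_nonneg (η 1), sq_nonneg (η 2)])
lemma rho_nonneg (η : V3) : 0 ≤ rho η := Real.sqrt_nonneg _

/-- good set -/
def Ug : Set (V3 × V3) := {p | p.2 ≠ 0 ∧ 0 < rho p.2 + p.2 2}

lemma rho_cont : Continuous rho := by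
  unfold rho; simp only [dotProduct]; fun_prop

lemma Ug_open : IsOpen Ug := by
  refine IsOpen.inter ?_ ?_
  · exact isOpen_ne_fun continuous_snd continuous_const
  · have := rho_cont
    exact isOpen_lt continuous_const ((this.comp continuous_snd).add ((continuous_apply 2).comp continuous_snd))

lemma ff_smooth {p : V3 × V3} (hp : p ∈ Ug) : ContDiffAt ℝ ∞ ff p := by
  have h1 := rho_pos hp.1
  have hrho : ContDiffAt ℝ ∞ (fun p : V3 × V3 => rho p.2) p := by
    refine ContDiffAt.sqrt ?_ (dot_self_pos hp.1).ne'
    exact (contDiff_dot contDiff_snd contDiff_snd).contDiffAt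
  have hd : ContDiffAt ℝ ∞ (fun p : V3 × V3 => p.1 ⬝ᵥ p.2) p := (contDiff_dot contDiff_fst contDiff_snd).contDiffAt
  have h1c : ∀ i, ContDiffAt ℝ ∞ (fun p : V3 × V3 => p.1 i) p := fun i => (contDiff_pi.1 contDiff_fst i).contDiffAt
  have h2c : ∀ i, ContDiffAt ℝ ∞ (fun p : V3 × V3 => p.2 i) p := fun i => (contDiff_pi.1 contDiff_snd i).contDiffAt
  refine ContDiffAt.prodMk ?_ hrho
  refine contDiffAt_pi.2 fun i => ?_
  have hne : rho p.2 * (rho p.2 + p.2 2) ≠ 0 := (mul_pos h1 hp.2).ne'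
  fin_cases i
  · exact (h1c 0).sub (((h2c 0).mul (hd.add (hrho.mul (h1c 2)))).div (hrho.mul (hrho.add (h2c 2))) hne)
  · exact (h1c 1).sub (((h2c 1).mul (hd.add (hrho.mul (h1c 2)))).div (hrho.mul (hrho.add (h2c 2))) hne)
  · exact hd.div hrho h1.ne'

lemma rho_smul {l : ℝ} (hl : 0 < l) (η : V3) : rho (l • η) = l * rho η := by
  rw [rho, rho]
  have : (l • η) ⬝ᵥ (l • η) = l^2 * (η ⬝ᵥ η) := by simp [smul_dotProduct, dotProduct_smul]; ring
  rw [this, Real.sqrt_mul (sq_nonneg l), Real.sqrt_sq hl.le]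

lemma ff_scale {m l : ℝ} (hm : 0 < m) (hl : 0 < l) (ξ η : V3) : ff (m • ξ, l • η) = (m • (ff (ξ, η)).1, l * (ff (ξ,η)).2) := by
  refine Prod.ext ?_ (rho_smul hl η)
  have hr := rho_smul hl η
  have hd : (m • ξ) ⬝ᵥ (l • η) = m * (l * (ξ ⬝ᵥ η)) := by simp [smul_dotProduct, dotProduct_smul]; ring
  have key : ∀ a b c d e x : ℝ, m * a - l * b * (m * (l * c) + l * x * (m * d)) / (l * x * (l * x + l * e)) =
     m * (a - b * (c + x * d) / (x * (x + e))) := by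
    intro a b c d e x
    have : l * b * (m * (l * c) + l * x * (m * d)) / (l * x * (l * x + l * e)) =
      (l^2 * (m * (b * (c + x * d)))) / (l^2 * (x * (x + e))) := by ring_nf
    rw [this, mul_div_mul_left _ _ (by positivity)]; ring
  funext i
  change fy (m • ξ, l • η) i = (m • fy (ξ, η)) i
  unfold fy
  simp only [hr, hd]
  fin_cases i
  · simp [key]
  · simp [key]
  · simp
    rw [show m * (l * (ξ ⬝ᵥ η)) = l * (m * (ξ ⬝ᵥ η)) by ring, mul_div_mul_left _ _ hl.ne']; ring
end PartL

section PartM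
open scoped ContDiff FourierTransform LineDeriv SchwartzMap

lemma rho_le (η : V3) : rho η ≤ 2 * ‖η‖ := by
  refine Real.sqrt_le_iff.2 ⟨by positivity, ?_⟩
  have := dot_le3 η
  nlinarith [sq_nonneg ‖η‖]
lemma le_rho (η : V3) : ‖η‖ ≤ rho η := Real.le_sqrt_of_sq_le (le_norm3 η)

lemma Ug_of {p : V3 × V3} (h : p.2 ≠ 0) (h' : 0 ≤ p.2 2) : p ∈ Ug := ⟨h, by have := rho_pos h; linarith⟩

def Kc : Set (V3 × V3) := {p | ‖p.1‖ ≤ 1 ∧ rho p.2 = 1 ∧ 0 ≤ p.2 2}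
lemma Kc_compact : IsCompact Kc := by
  refine Metric.isCompact_of_isClosed_isBounded ?_ ?_
  · have := rho_cont
    refine IsClosed.inter (isClosed_le (continuous_norm.comp continuous_fst) continuous_const) (IsClosed.inter ?_ ?_)
    · exact isClosed_eq (this.comp continuous_snd) continuous_const
    · exact isClosed_le continuous_const ((continuous_apply 2).comp continuous_snd)
  · refine Metric.isBounded_closedBall (x := 0) (r := 1) |>.subset ?_
    intro p hp
    rw [mem_closedBall_zero_iff, Prod.norm_def]
    refine max_le hp.1 ((le_rho _).trans hp.2.1.le)

lemma Kc_sub : Kc ⊆ Ug := by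
  intro p hp
  refine Ug_of ?_ hp.2.2
  intro h0
  have := hp.2.1
  rw [h0] at this
  simp [rho] at this

def sc (W : Type) [NormedAddCommGroup W] [NormedSpace ℝ W] (m l : ℝ) : (V3 × W) →L[ℝ] (V3 × W) :=
  (m • ContinuousLinearMap.id ℝ V3).prodMap (l • ContinuousLinearMap.id ℝ W)

lemma sc_apply (W : Type) [NormedAddCommGroup W] [NormedSpace ℝ W] (m l : ℝ) (p : V3 × W) : sc W m l p = (m • p.1, l • p.2) := rfl

lemma sc_norm (W : Type) [NormedAddCommGroup W] [NormedSpace ℝ W] (m l M : ℝ) (hm : |m| ≤ M) (hl : |l| ≤ M) : ‖sc W m l‖ ≤ M := by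
  have hM : 0 ≤ M := (abs_nonneg _).trans hm
  refine ContinuousLinearMap.opNorm_le_bound _ hM fun p => ?_
  rw [sc_apply, Prod.norm_def]
  simp only [norm_smul, Real.norm_eq_abs]
  exact max_le (mul_le_mul hm (norm_fst_le p) (norm_nonneg _) hM) (mul_le_mul hl (norm_snd_le p) (norm_nonneg _) hM)

lemma ff_bound (i : ℕ) : ∃ C, 1 ≤ C ∧ ∀ p : V3 × V3, p.2 ≠ 0 → 0 ≤ p.2 2 →
    ‖iteratedFDeriv ℝ i ff p‖ ≤ C * (1 + ‖p‖) * ((min 1 (rho p.2))⁻¹)^i := by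
  obtain ⟨C, hC⟩ := Kc_compact.exists_bound_of_continuousOn (f := iteratedFDeriv ℝ i ff) (by
    intro p hp
    have := (ff_smooth (Kc_sub hp)).iteratedFDeriv_right (m := 0) (i := i) (by simp; exact_mod_cast le_top)
    exact this.continuousAt.continuousWithinAt)
  refine ⟨max 1 (2 * |C|), le_max_left _ _, fun p h1 h2 => ?_⟩
  have hr := rho_pos h1
  set m := (1 + ‖p.1‖)⁻¹ with hm
  set l := (rho p.2)⁻¹ with hl
  have hm0 : 0 < m := by positivity
  have hl0 : 0 < l := by positivity
  have hU := Ug_of h1 h2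
  have hBK : sc V3 m l p ∈ Kc := by
    refine ⟨?_, ?_, ?_⟩
    · simp only [sc_apply, norm_smul, Real.norm_eq_abs, abs_of_pos hm0]
      rw [hm, inv_mul_le_iff₀ (by positivity)]; linarith
    · simp only [sc_apply, rho_smul hl0]
      exact inv_mul_cancel₀ hr.ne'
    · simp only [sc_apply, Pi.smul_apply, smul_eq_mul]; positivity
  have hBU := Kc_sub hBK
  have hfe : ff = sc ℝ m⁻¹ l⁻¹ ∘ (ff ∘ sc V3 m l) := by
    funext q
    simp only [Function.comp, sc_apply, ff_scale hm0 hl0]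
    ext <;> simp [hm0.ne', hl0.ne']
  have hcd : ContDiffAt ℝ ∞ (ff ∘ sc V3 m l) p := (ff_smooth hBU).comp p (sc V3 m l).contDiff.contDiffAt
  have hD : iteratedFDeriv ℝ i ff p = (sc ℝ m⁻¹ l⁻¹).compContinuousMultilinearMap
      ((iteratedFDeriv ℝ i ff (sc V3 m l p)).compContinuousLinearMap fun _ => sc V3 m l) := by
    conv_lhs => rw [hfe]
    rw [ContinuousLinearMap.iteratedFDeriv_comp_left _ hcd (i := i) (by exact_mod_cast le_top)]
    congr 1
    have ho : IsOpen (sc V3 m l ⁻¹' Ug) := Ug_open.preimage (sc V3 m l).continuous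
    have := (sc V3 m l).iteratedFDerivWithin_comp_right (f := ff) (s := Ug) (n := ∞) (x := p) (i := i)
      (fun q hq => (ff_smooth hq).contDiffWithinAt) Ug_open.uniqueDiffOn ho.uniqueDiffOn hBU (by exact_mod_cast le_top)
    rwa [iteratedFDerivWithin_of_isOpen i ho hBU, iteratedFDerivWithin_of_isOpen i Ug_open hBU] at this
  rw [hD]
  have hn1 : ‖sc ℝ m⁻¹ l⁻¹‖ ≤ 2 * (1 + ‖p‖) := by
    have a := norm_fst_le p
    have b := norm_snd_le p
    have c := rho_le p.2
    refine sc_norm _ _ _ _ ?_ ?_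
    · rw [abs_of_pos (by positivity), hm, inv_inv]; nlinarith [norm_nonneg p]
    · rw [abs_of_pos (by positivity), hl, inv_inv]; linarith
  have hn2 : ‖sc V3 m l‖ ≤ (min 1 (rho p.2))⁻¹ := by
    have hmin : 0 < min 1 (rho p.2) := lt_min one_pos hr
    refine sc_norm _ _ _ _ ?_ ?_
    · rw [abs_of_pos hm0, hm]
      refine inv_anti₀ hmin ((min_le_left _ _).trans ?_)
      linarith [norm_nonneg p.1]
    · rw [abs_of_pos hl0, hl]
      exact inv_anti₀ hmin (min_le_right _ _)
  refine (ContinuousLinearMap.norm_compContinuousMultilinearMap_le _ _).trans ?_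
  have h3 := ContinuousMultilinearMap.norm_compContinuousLinearMap_le (iteratedFDeriv ℝ i ff (sc V3 m l p)) (fun _ => sc V3 m l)
  simp only [Finset.prod_const, Finset.card_univ, Fintype.card_fin] at h3
  have h4 := (hC _ hBK).trans (le_abs_self C)
  calc _ ≤ (2 * (1 + ‖p‖)) * (|C| * ((min 1 (rho p.2))⁻¹)^i) := by
        refine mul_le_mul hn1 (h3.trans ?_) (norm_nonneg _) (by positivity)
        gcongr
    _ = (2 * |C|) * (1 + ‖p‖) * ((min 1 (rho p.2))⁻¹)^i := by ring
    _ ≤ _ := by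
        have : 0 < min 1 (rho p.2) := lt_min one_pos hr
        gcongr
        exact le_max_right _ _

/-- uniform version -/
lemma ff_bound' (n : ℕ) : ∃ C, 1 ≤ C ∧ ∀ p : V3 × V3, p.2 ≠ 0 → 0 ≤ p.2 2 → ∀ i, 1 ≤ i → i ≤ n →
    ‖iteratedFDeriv ℝ i ff p‖ ≤ (C * (1 + ‖p‖) * (min 1 (rho p.2))⁻¹)^i := by
  choose C hC1 hC using ff_bound
  refine ⟨∑ i ∈ Finset.range (n+1), C i, ?_, ?_⟩
  · refine (hC1 0).trans ?_
    exact Finset.single_le_sum (f := C) (fun i _ => zero_le_one.trans (hC1 i)) (by simp)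
  · intro p h1 h2 i hi hin
    refine (hC i p h1 h2).trans ?_
    have hle : C i ≤ ∑ i ∈ Finset.range (n+1), C i :=
      Finset.single_le_sum (f := C) (fun i _ => zero_le_one.trans (hC1 i)) (Finset.mem_range.2 (by omega))
    have hp := norm_nonneg p
    have h1' : 1 ≤ (∑ i ∈ Finset.range (n+1), C i) * (1 + ‖p‖) := by nlinarith [hC1 i]
    have : 0 < min 1 (rho p.2) := lt_min one_pos (rho_pos h1)
    rw [mul_pow _ (min 1 (rho p.2))⁻¹]
    gcongr
    calc _ ≤ (∑ i ∈ Finset.range (n+1), C i) * (1 + ‖p‖) := by gcongr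
      _ ≤ _ := le_self_pow₀ h1' (by omega)
end PartM

section PartN
open scoped ContDiff FourierTransform LineDeriv SchwartzMap

lemma exists_rot {η : V3} (h1 : η ≠ 0) (h2 : 0 < rho η + η 2) : ∃ A : Mat3, A * A.transpose = 1 ∧
    (∀ ξ, A *ᵥ ξ = fy (ξ, η)) ∧ A *ᵥ η = ![0, 0, rho η] := by
  have hr := rho_pos h1
  have hs := rho_sq η
  set r := rho η with hrd
  have hr2 : 0 < r + η 2 := h2
  obtain ⟨u, hu⟩ : ∃ u : V3, η = r • u := ⟨r⁻¹ • η, by rw [smul_smul, mul_inv_cancel₀ hr.ne', one_smul]⟩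
  have hu1 : u 0^2 + u 1^2 + u 2^2 = 1 := by
    have : r^2 * (u 0^2 + u 1^2 + u 2^2) = r^2 * 1 := by
      rw [mul_one]
      nth_rewrite 2 [hs]
      rw [hu]; simp [dotProduct, Fin.sum_univ_three]; ring
    exact mul_left_cancel₀ (by positivity) this
  have e0 : η 0 = r * u 0 := congrFun hu 0
  have e1 : η 1 = r * u 1 := congrFun hu 1
  have e2 : η 2 = r * u 2 := congrFun hu 2
  have hu2 : 0 < 1 + u 2 := by
    rw [e2] at hr2
    by_contra hc
    nlinarith
  set q := (1 + u 2)⁻¹ with hq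
  have hq1 : q * (1 + u 2) = 1 := inv_mul_cancel₀ hu2.ne'
  have hq2 : q * (u 0^2 + u 1^2) = 1 - u 2 := by
    linear_combination q * hu1 + (1 - u 2) * hq1
  refine ⟨!![1 - q * u 0^2, -(q * u 0 * u 1), -u 0; -(q * u 0 * u 1), 1 - q * u 1^2, -u 1; u 0, u 1, u 2], ?_, ?_, ?_⟩
  · ext i j
    fin_cases i <;> fin_cases j <;> simp [Matrix.mul_apply, Fin.sum_univ_three]
    · linear_combination (u 0^2 * q) * hq2 - u 0^2 * hq1
    · linear_combination (u 0 * u 1 * q) * hq2 - u 0 * u 1 * hq1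
    · linear_combination (-u 0) * hq2
    · linear_combination (u 0 * u 1 * q) * hq2 - u 0 * u 1 * hq1
    · linear_combination (u 1^2 * q) * hq2 - u 1^2 * hq1
    · linear_combination (-u 1) * hq2
    · linear_combination (-u 0) * hq2
    · linear_combination (-u 1) * hq2
    · linear_combination hu1
  · intro ξ
    have k : ∀ b c d : ℝ, r * b * (r * c + r * d) / (r * (r + r * u 2)) = b * (c + d) * q := by
      intro b c d
      rw [hq]; field_simp
    have kd : ξ ⬝ᵥ η = r * (ξ 0 * u 0 + ξ 1 * u 1 + ξ 2 * u 2) := by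
      rw [hu]; simp [dotProduct, Fin.sum_univ_three]; ring
    unfold fy
    simp only [← hrd, kd, e0, e1, e2, k]
    funext i
    fin_cases i
    · simp [Matrix.mulVec, dotProduct, Fin.sum_univ_three]
      linear_combination (u 0 * ξ 2) * hq1
    · simp [Matrix.mulVec, dotProduct, Fin.sum_univ_three]
      linear_combination (u 1 * ξ 2) * hq1
    · simp [Matrix.mulVec, dotProduct, Fin.sum_univ_three]
      field_simp
  · funext i
    fin_cases i
    · simp [Matrix.mulVec, dotProduct, Fin.sum_univ_three, e0, e1, e2]
      linear_combination (-r * u 0) * hq2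
    · simp [Matrix.mulVec, dotProduct, Fin.sum_univ_three, e0, e1, e2]
      linear_combination (-r * u 1) * hq2
    · simp [Matrix.mulVec, dotProduct, Fin.sum_univ_three, e0, e1, e2]
      linear_combination r * hu1

lemma ff_lower {p : V3 × V3} (h1 : p.2 ≠ 0) (h2 : 0 ≤ p.2 2) : 1 + ‖p‖ ≤ 2 * (1 + ‖ff p‖) := by
  obtain ⟨A, hA, hA1, hA2⟩ := exists_rot h1 (Ug_of h1 h2).2
  have h3 : fy p ⬝ᵥ fy p = p.1 ⬝ᵥ p.1 := by rw [show p = (p.1, p.2) from rfl, ← hA1, orth_dot hA]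
  have h4 : ‖p.1‖ ≤ 2 * ‖fy p‖ := by
    have a := le_norm3 p.1
    have b := dot_le3 (fy p)
    rw [h3] at b
    refine abs_le_of_sq_le_sq' ?_ (by positivity) |>.2
    nlinarith [sq_nonneg ‖fy p‖]
  have h5 := le_rho p.2
  have h6 : ‖fy p‖ ≤ ‖ff p‖ := norm_fst_le (ff p)
  have h7 : rho p.2 ≤ ‖ff p‖ := (le_abs_self _).trans (norm_snd_le (ff p))
  have : ‖p‖ ≤ 2 * ‖ff p‖ := by
    rw [Prod.norm_def p]
    refine max_le (by linarith) ?_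
    linarith [norm_nonneg (ff p)]
  linarith

lemma comp_bound (R : 𝓢(V3 × ℝ, ℂ)) {N : ℕ} (hR : Van N R) (n k : ℕ) (hn : 2 * n + 2 ≤ N) :
    ∃ C, 0 ≤ C ∧ ∀ p : V3 × V3, p.2 ≠ 0 → 0 ≤ p.2 2 →
      (1+‖p‖)^k * ‖iteratedFDeriv ℝ n (R ∘ ff) p‖ ≤ C * (min 1 (rho p.2))^2 := by
  choose B hB0 hB using fun i => Van.bound' (k + n) i N R hR
  obtain ⟨D, hD1, hD⟩ := ff_bound' n
  set S := ∑ i ∈ Finset.range (n+1), B i with hS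
  have hS0 : 0 ≤ S := Finset.sum_nonneg fun i _ => hB0 i
  have hBS : ∀ i ≤ n, B i ≤ S := fun i hi => Finset.single_le_sum (f := B) (fun i _ => hB0 i) (Finset.mem_range.2 (by omega))
  refine ⟨n.factorial * (2^(k+n) * S) * D^n, by positivity, fun p h1 h2 => ?_⟩
  have hr := rho_pos h1
  set μ := min 1 (rho p.2) with hμ
  have hμ0 : 0 < μ := lt_min one_pos hr
  have hμ1 : μ ≤ 1 := min_le_left _ _
  have hU := Ug_of h1 h2
  have hlow := ff_lower h1 h2
  have hp0 : 0 < 1 + ‖p‖ := by positivity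
  have hC : ∀ i, i ≤ n → ‖iteratedFDeriv ℝ i R (ff p)‖ ≤ 2^(k+n) * S * μ^(n+2) * ((1+‖p‖)^(k+n))⁻¹ := by
    intro i hi
    have h := hB i (ff p)
    have e : |(ff p).2| = rho p.2 := abs_of_pos hr
    rw [e] at h
    rw [← div_eq_mul_inv, le_div_iff₀ (by positivity)]
    calc _ ≤ ‖iteratedFDeriv ℝ i R (ff p)‖ * (2 * (1 + ‖ff p‖))^(k+n) := by gcongr
      _ = 2^(k+n) * ((1 + ‖ff p‖)^(k+n) * ‖iteratedFDeriv ℝ i R (ff p)‖) := by rw [mul_pow]; ring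
      _ ≤ 2^(k+n) * (B i * μ^(N-i)) := by gcongr
      _ ≤ 2^(k+n) * (S * μ^(n+2)) := by
        gcongr 2^(k+n) * (?_ * ?_)
        · exact hBS i hi
        · exact pow_le_pow_of_le_one hμ0.le hμ1 (by omega)
      _ = _ := by ring
  have hmain := norm_iteratedFDerivWithin_comp_le (g := R) (f := ff) (s := Ug) (t := Set.univ) (x := p) (n := n) (N := ∞)
    (R.smooth ⊤).contDiffOn (fun q hq => (ff_smooth hq).contDiffWithinAt) (by exact_mod_cast le_top)
    uniqueDiffOn_univ Ug_open.uniqueDiffOn (Set.mapsTo_univ _ _) hU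
    (by simpa only [iteratedFDerivWithin_univ] using hC)
    (D := D * (1 + ‖p‖) * μ⁻¹)
    (by
      intro i hi hin
      rw [iteratedFDerivWithin_of_isOpen i Ug_open hU]
      exact hD p h1 h2 i hi hin)
  rw [iteratedFDerivWithin_of_isOpen n Ug_open hU] at hmain
  calc _ ≤ (1+‖p‖)^k * (n.factorial * (2^(k+n) * S * μ^(n+2) * ((1+‖p‖)^(k+n))⁻¹) * (D * (1 + ‖p‖) * μ⁻¹)^n) := by gcongr
    _ = n.factorial * (2^(k+n) * S) * D^n * μ^2 * ((1+‖p‖)^(k+n) * ((1+‖p‖)^(k+n))⁻¹) * (μ * μ⁻¹)^n := by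
      rw [mul_pow (D * (1 + ‖p‖)), mul_pow D]; ring
    _ = _ := by
      rw [mul_inv_cancel₀ (by positivity), mul_inv_cancel₀ hμ0.ne']; ring
end PartN

section PartO
open scoped ContDiff FourierTransform LineDeriv SchwartzMap

def phi (H : V3 × ℝ → ℂ) (p : V3 × V3) : ℂ :=
  if p.2 = 0 then H (p.1, 0) else
    H (![√(p.1 ⬝ᵥ p.1 - (p.1 ⬝ᵥ p.2 / rho p.2)^2), 0, p.1 ⬝ᵥ p.2 / rho p.2], rho p.2)

lemma phi_orth {H : V3 × ℝ → ℂ} {A : Mat3} (h : A * A.transpose = 1) (hH : ∀ ξ, H (A *ᵥ ξ, 0) = H (ξ, 0)) (ξ η : V3) :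
    phi H (A *ᵥ ξ, A *ᵥ η) = phi H (ξ, η) := by
  have e : A *ᵥ η = 0 ↔ η = 0 := (oL A h).map_eq_zero_iff
  unfold phi rho
  simp only [e, orth_dot h, hH]

lemma phi_ff {H : V3 × ℝ → ℂ} (hH : InvK' H) {p : V3 × V3} (hp : p ∈ Ug) : phi H p = H (ff p) := by
  obtain ⟨A, hA, hA1, hA2⟩ := exists_rot hp.1 hp.2
  have h3 : fy p ⬝ᵥ fy p = p.1 ⬝ᵥ p.1 := by rw [show p = (p.1, p.2) from rfl, ← hA1, orth_dot hA]
  rw [phi, if_neg hp.1]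
  change _ = H (fy p, rho p.2)
  have e2 : fy p 2 = p.1 ⬝ᵥ p.2 / rho p.2 := rfl
  have e3 : p.1 ⬝ᵥ p.1 - (p.1 ⬝ᵥ p.2 / rho p.2)^2 = fy p 0^2 + fy p 1^2 := by
    rw [← h3, ← e2]; simp only [dotProduct, Fin.sum_univ_three]; ring
  rw [e3]
  apply invK_eq hH
  · simp; rw [Real.sq_sqrt (by positivity)]
  · exact e2.symm

section
variable (G : 𝓢(V3 × ℝ, ℂ)) (hG : InvK' G) (a : ℕ → ℕ → 𝓢(ℝ, ℂ))
  (h : ∀ j x, mom j G x = ∑ i ∈ Finset.range (j+1), if Even (j-i) then a j i (x ⬝ᵥ x) * (x 2 : ℂ)^i else 0)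

def SP (N : ℕ) : 𝓢(V3 × V3, ℂ) := ∑ j ∈ Finset.range N, PP j (a j)
lemma SP_apply (N : ℕ) (p) : SP a N p = ∑ j ∈ Finset.range N, PP j (a j) p := by
  rw [SP, _root_.sum_apply]

lemma SP_orth (N : ℕ) {A : Mat3} (hA : A * A.transpose = 1) (ξ η : V3) :
    SP a N (A *ᵥ ξ, A *ᵥ η) = SP a N (ξ, η) := by
  rw [SP_apply, SP_apply]; exact Finset.sum_congr rfl fun j _ => PP_orth j _ hA _ _

def Psi (N : ℕ) (p : V3 × V3) : ℂ := phi (FT4 G) p - SP a N p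

end

lemma H_zero {G : 𝓢(V3 × ℝ, ℂ)} {a : ℕ → ℕ → 𝓢(ℝ, ℂ)}
    (h : ∀ j x, mom j G x = ∑ i ∈ Finset.range (j+1), if Even (j-i) then a j i (x ⬝ᵥ x) * (x 2 : ℂ)^i else 0)
    {N : ℕ} (hN : 0 < N) (ξ : V3) : FT4 G (ξ, 0) = SP a N (ξ, 0) := by
  have h1 := RN_van N a G h 0 hN ξ
  simp only [Function.iterate_zero, id] at h1
  rw [RN_apply, sub_eq_zero] at h1
  rw [h1, SP_apply]
  have : (![0,0,0] : V3) = 0 := by funext i; fin_cases i <;> rfl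
  rw [this]

lemma H_zero_orth {G : 𝓢(V3 × ℝ, ℂ)} {a : ℕ → ℕ → 𝓢(ℝ, ℂ)}
    (h : ∀ j x, mom j G x = ∑ i ∈ Finset.range (j+1), if Even (j-i) then a j i (x ⬝ᵥ x) * (x 2 : ℂ)^i else 0)
    {A : Mat3} (hA : A * A.transpose = 1) (ξ : V3) : FT4 G (A *ᵥ ξ, 0) = FT4 G (ξ, 0) := by
  rw [H_zero h one_pos, H_zero h one_pos]
  have := SP_orth a 1 hA ξ 0
  rwa [mulVec_zero] at this

lemma Psi_zero {G : 𝓢(V3 × ℝ, ℂ)} {a : ℕ → ℕ → 𝓢(ℝ, ℂ)}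
    (h : ∀ j x, mom j G x = ∑ i ∈ Finset.range (j+1), if Even (j-i) then a j i (x ⬝ᵥ x) * (x 2 : ℂ)^i else 0)
    {N : ℕ} (hN : 0 < N) (p : V3 × V3) (hp : p.2 = 0) : Psi G a N p = 0 := by
  rw [Psi, phi, if_pos hp, H_zero h hN, ← hp, sub_self]

lemma Psi_even {G : 𝓢(V3 × ℝ, ℂ)} {a : ℕ → ℕ → 𝓢(ℝ, ℂ)}
    (h : ∀ j x, mom j G x = ∑ i ∈ Finset.range (j+1), if Even (j-i) then a j i (x ⬝ᵥ x) * (x 2 : ℂ)^i else 0)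
    (N : ℕ) (p : V3 × V3) : Psi G a N (-p) = Psi G a N p := by
  have hA : (-1 : Mat3) * (-1 : Mat3).transpose = 1 := by simp
  have e : -p = ((-1 : Mat3) *ᵥ p.1, (-1 : Mat3) *ᵥ p.2) := by
    simp [neg_mulVec]; rfl
  rw [Psi, Psi, e, phi_orth hA (H_zero_orth h hA), SP_orth a N hA]

lemma Psi_ff {G : 𝓢(V3 × ℝ, ℂ)} (hG : InvK' G) {a : ℕ → ℕ → 𝓢(ℝ, ℂ)} (N : ℕ) {p : V3 × V3} (hp : p ∈ Ug) :
    Psi G a N p = RN N a G (ff p) := by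
  obtain ⟨A, hA, hA1, hA2⟩ := exists_rot hp.1 hp.2
  rw [Psi, phi_ff (FT4_invK hG) hp, ff, RN_apply]
  congr 1
  rw [← SP_apply, ← hA2, show p = (p.1, p.2) from rfl, ← hA1, SP_orth a N hA]

lemma Psi_ev {G : 𝓢(V3 × ℝ, ℂ)} (hG : InvK' G) {a : ℕ → ℕ → 𝓢(ℝ, ℂ)} (N : ℕ) {p : V3 × V3} (hp : p ∈ Ug) :
    Psi G a N =ᶠ[nhds p] (RN N a G ∘ ff) := by
  filter_upwards [Ug_open.mem_nhds hp] with q hq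
  exact Psi_ff hG N hq

lemma Psi_smooth {G : 𝓢(V3 × ℝ, ℂ)} (hG : InvK' G) {a : ℕ → ℕ → 𝓢(ℝ, ℂ)}
    (h : ∀ j x, mom j G x = ∑ i ∈ Finset.range (j+1), if Even (j-i) then a j i (x ⬝ᵥ x) * (x 2 : ℂ)^i else 0)
    (N : ℕ) (p : V3 × V3) (hp : p.2 ≠ 0) : ContDiffAt ℝ ∞ (Psi G a N) p := by
  have key : ∀ q ∈ Ug, ContDiffAt ℝ ∞ (Psi G a N) q := fun q hq =>
    (((RN N a G).smooth ⊤).contDiffAt.comp q (ff_smooth hq)).congr_of_eventuallyEq (Psi_ev hG N hq)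
  rcases le_total 0 (p.2 2) with hs | hs
  · exact key p (Ug_of hp hs)
  · have hU : -p ∈ Ug := Ug_of (by simpa using hp) (by simpa using hs)
    have e : Psi G a N = Psi G a N ∘ (fun q => -q) := by funext q; exact (Psi_even h N q).symm
    rw [e]
    exact (key (-p) hU).comp p contDiff_neg.contDiffAt

lemma Psi_bound {G : 𝓢(V3 × ℝ, ℂ)} (hG : InvK' G) {a : ℕ → ℕ → 𝓢(ℝ, ℂ)}
    (h : ∀ j x, mom j G x = ∑ i ∈ Finset.range (j+1), if Even (j-i) then a j i (x ⬝ᵥ x) * (x 2 : ℂ)^i else 0)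
    (n k N : ℕ) (hN : 2 * n + 2 ≤ N) : ∃ C, 0 ≤ C ∧ ∀ p : V3 × V3, p.2 ≠ 0 →
      (1+‖p‖)^k * ‖iteratedFDeriv ℝ n (Psi G a N) p‖ ≤ C * (min 1 (rho p.2))^2 := by
  obtain ⟨C, hC0, hC⟩ := comp_bound (RN N a G) (RN_van N a G h) n k hN
  have key : ∀ p : V3 × V3, p.2 ≠ 0 → 0 ≤ p.2 2 →
      (1+‖p‖)^k * ‖iteratedFDeriv ℝ n (Psi G a N) p‖ ≤ C * (min 1 (rho p.2))^2 := by
    intro p h1 h2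
    rw [((Psi_ev hG N (Ug_of h1 h2)).iteratedFDeriv ℝ n).eq_of_nhds]
    exact hC p h1 h2
  refine ⟨C, hC0, fun p hp => ?_⟩
  rcases le_total 0 (p.2 2) with hs | hs
  · exact key p hp hs
  · have h1 := key (-p) (by simpa using hp) (by simpa using hs)
    have e : Psi G a N = Psi G a N ∘ (LinearIsometryEquiv.neg ℝ : (V3 × V3) ≃ₗᵢ[ℝ] (V3 × V3)) := by
      funext q; exact (Psi_even h N q).symm
    have er : rho (-p).2 = rho p.2 := by simp [rho]
    rw [norm_neg, er] at h1
    rw [e, LinearIsometryEquiv.norm_iteratedFDeriv_comp_right]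
    exact h1

lemma Psi_final {G : 𝓢(V3 × ℝ, ℂ)} (hG : InvK' G) {a : ℕ → ℕ → 𝓢(ℝ, ℂ)}
    (h : ∀ j x, mom j G x = ∑ i ∈ Finset.range (j+1), if Even (j-i) then a j i (x ⬝ᵥ x) * (x 2 : ℂ)^i else 0)
    (n k : ℕ) : ContDiff ℝ n (Psi G a (2*n+2)) ∧ ∃ C, ∀ p, ‖p‖^k * ‖iteratedFDeriv ℝ n (Psi G a (2*n+2)) p‖ ≤ C := by
  obtain ⟨h1, h2⟩ := ext_lemma n (Psi G a (2*n+2)) (Psi_smooth hG h _) (Psi_zero h (by omega)) (by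
    intro i hi
    obtain ⟨C, hC0, hC⟩ := Psi_bound hG h i 0 (2*n+2) (by omega)
    refine ⟨C * 4, by positivity, fun p hp => ?_⟩
    have := hC p hp
    rw [pow_zero, one_mul] at this
    refine this.trans ?_
    have h3 : min 1 (rho p.2) ≤ 2 * ‖p.2‖ := (min_le_right _ _).trans (rho_le _)
    have h4 : 0 ≤ min 1 (rho p.2) := le_min zero_le_one (rho_nonneg _)
    calc _ ≤ C * (2 * ‖p.2‖)^2 := by gcongr
      _ = _ := by ring)
  refine ⟨h1, ?_⟩
  obtain ⟨C, hC0, hC⟩ := Psi_bound hG h n k (2*n+2) le_rfl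
  refine ⟨C, fun p => ?_⟩
  by_cases hp : p.2 = 0
  · rw [h2 n le_rfl p hp]; simpa using hC0
  · calc _ ≤ (1 + ‖p‖)^k * ‖iteratedFDeriv ℝ n (Psi G a (2*n+2)) p‖ := by gcongr; linarith
      _ ≤ _ := hC p hp
      _ ≤ C * 1^2 := by
        have h4 : 0 ≤ min 1 (rho p.2) := le_min zero_le_one (rho_nonneg _)
        gcongr; exact min_le_left _ _
      _ = C := by ring

def Phi (G : 𝓢(V3 × ℝ, ℂ)) (hG : InvK' G) (a : ℕ → ℕ → 𝓢(ℝ, ℂ))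
    (h : ∀ j x, mom j G x = ∑ i ∈ Finset.range (j+1), if Even (j-i) then a j i (x ⬝ᵥ x) * (x 2 : ℂ)^i else 0) :
    𝓢(V3 × V3, ℂ) where
  toFun := phi (FT4 G)
  smooth' := by
    rw [contDiff_infty]
    intro n
    have e : phi (FT4 G) = Psi G a (2*n+2) + SP a (2*n+2) := by funext p; simp [Psi]
    rw [e]
    exact (Psi_final hG h n 0).1.add ((SP a (2*n+2)).smooth n)
  decay' := by
    intro k n
    have e : phi (FT4 G) = Psi G a (2*n+2) + SP a (2*n+2) := by funext p; simp [Psi]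
    obtain ⟨h1, C, hC⟩ := Psi_final hG h n k
    obtain ⟨D, hD⟩ := (SP a (2*n+2)).decay' k n
    refine ⟨C + D, fun p => ?_⟩
    rw [e, iteratedFDeriv_add_apply h1.contDiffAt ((SP a (2*n+2)).smooth n).contDiffAt]
    calc _ ≤ ‖p‖^k * (‖iteratedFDeriv ℝ n (Psi G a (2*n+2)) p‖ + ‖iteratedFDeriv ℝ n (SP a (2*n+2)) p‖) := by
          gcongr; exact norm_add_le _ _
      _ ≤ C + D := by rw [mul_add]; exact add_le_add (hC p) (hD p)

lemma phi_line {H : V3 × ℝ → ℂ} (hH : InvK' H) (ξ : V3) (s : ℝ) : phi H (ξ, ![0,0,s]) = H (ξ, s) := by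
  have hr : rho ![0,0,s] = |s| := by simp [rho, dotProduct, Fin.sum_univ_three, Real.sqrt_mul_self_eq_abs]
  have hd : ξ ⬝ᵥ ![0,0,s] = ξ 2 * s := by simp [dotProduct, Fin.sum_univ_three]
  by_cases hs : s = 0
  · have : (![0,0,s] : V3) = 0 := by rw [hs]; funext i; fin_cases i <;> rfl
    rw [phi, if_pos this, hs]
  · have : (![0,0,s] : V3) ≠ 0 := by
      intro h0; exact hs (congrFun h0 2)
    rw [phi, if_neg this]
    simp only [hr, hd]
    rcases lt_or_gt_of_ne hs with h0 | h0
    · have e : ξ 2 * s / |s| = - ξ 2 := by rw [abs_of_neg h0]; field_simp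
      rw [e, abs_of_neg h0, ← invK_flip hH ξ s]
      apply invK_eq hH
      · simp only [dotProduct, Fin.sum_univ_three]
        simp; rw [Real.sq_sqrt] <;> nlinarith [sq_nonneg (ξ 0), sq_nonneg (ξ 1)]
      · simp
    · have e : ξ 2 * s / |s| = ξ 2 := by rw [abs_of_pos h0]; field_simp
      rw [e, abs_of_pos h0]
      apply invK_eq hH
      · simp only [dotProduct, Fin.sum_univ_three]
        simp; rw [Real.sq_sqrt] <;> nlinarith [sq_nonneg (ξ 0), sq_nonneg (ξ 1)]
      · simp

theorem backward (G : 𝓢(V3 × ℝ, ℂ)) (hG : InvK' G)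
    (h0 : ∀ j : ℕ, ∃ a : ℕ → 𝓢(ℝ, ℂ), ∀ x : V3, mom j G x = ∑ i ∈ Finset.range (j+1), a i (x ⬝ᵥ x) * (x 2 : ℂ)^i) :
    ∃ F : 𝓢(V3 × V3, ℂ), Inv3 F ∧ ∀ (x : V3) (t : ℝ), RadonT F x t = G (x, t) := by
  choose a ha using h0
  have h : ∀ j x, mom j G x = ∑ i ∈ Finset.range (j+1), if Even (j-i) then a j i (x ⬝ᵥ x) * (x 2 : ℂ)^i else 0 :=
    fun j x => parity_mom G hG j (a j) (ha j) x
  set Q := Phi G hG a h with hQ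
  have hQa : ∀ p, Q p = phi (FT4 G) p := fun p => rfl
  set F := FTgi e6 Q with hF
  have hFQ : FT6 F = Q := FTg_FTgi e6 Q
  refine ⟨F, ?_, ?_⟩
  · intro k hk x y
    have h1 : SchwartzMap.compCLMOfContinuousLinearEquiv ℂ ((oL k hk.1).prodCongr (oL k hk.1)) F = F := by
      apply FTg_inj e6
      have := FT6_orth hk.1 F
      rw [hFQ] at this
      refine this.trans (Eq.trans ?_ hFQ.symm)
      ext p
      change Q (k *ᵥ p.1, k *ᵥ p.2) = Q (p.1, p.2)
      rw [hQa, hQa, phi_orth hk.1 (H_zero_orth h hk.1)]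
    exact DFunLike.congr_fun h1 (x, y)
  · intro x t
    rw [← rad_apply]
    have : rad F = G := by
      apply FTg_inj e4
      ext p
      obtain ⟨ξ, s⟩ := p
      refine (FT4_rad F ξ s).trans ?_
      rw [hFQ, hQa, phi_line (FT4_invK hG)]
    rw [this]
end PartO

/-- Characterisation of the image of `𝒮(N_{3,2})^{SO(3)}` under the Radon-type map `R`:
`G = RF` for some Schwartz `SO(3)`-invariant `F` iff all the `t`-moments of `G` are of the
form `Σ_{i≤j} a_{j,i}(|x|²) x₃^i` with `a_{j,i}` Schwartz. -/
theorem statement7 (G : SchwartzMap ((Fin 3 → ℝ) × ℝ) ℂ) (hG : InvK' ⇑G) :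
    (∃ F : SchwartzMap (V3 × V3) ℂ, Inv3 ⇑F ∧ ∀ (x : V3) (t : ℝ), RadonT ⇑F x t = G (x, t)) ↔
    (∀ j : ℕ, ∃ a : ℕ → SchwartzMap ℝ ℂ, ∀ x : V3,
      ∫ t : ℝ, G (x, t) * (t : ℂ) ^ j
        = ∑ i ∈ Finset.range (j + 1), a i (x 0 ^ 2 + x 1 ^ 2 + x 2 ^ 2) * (x 2 : ℂ) ^ i) := by
  constructor
  · rintro ⟨F, hF, h⟩ j
    obtain ⟨a, ha⟩ := forward G hG F hF h j
    exact ⟨a, fun x => by rw [← mom_apply]; exact ha x⟩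
  · intro h0
    refine backward G hG fun j => ?_
    obtain ⟨a, ha⟩ := h0 j
    refine ⟨a, fun x => ?_⟩
    rw [mom_apply, ha x]
    have e : x 0^2+x 1^2+x 2^2 = x ⬝ᵥ x := by simp [dotProduct, Fin.sum_univ_three, sq]
    rw [e]
end
end

section
/- The real polynomials |x|², |y|², and x·y generate, as an ℝ-algebra, the algebra of all real polynomial functions on ℝ³×ℝ³ that are invariant under the simultaneous action of SO(3) on each copy of ℝ³ (i.e. P(kx,ky)=P(x,y) for all k∈SO(3)). -/
open MeasureTheory Complex Matrix

noncomputable section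

/-- `P` is a (real) polynomial function on `ℝ³ × ℝ³`. -/
def IsPolyFun6 (P : V3 × V3 → ℝ) : Prop :=
  ∃ Q : MvPolynomial (Fin 6) ℝ, ∀ p : V3 × V3,
    P p = MvPolynomial.eval ![p.1 0, p.1 1, p.1 2, p.2 0, p.2 1, p.2 2] Q


open MvPolynomial in
lemma avg_lem (Q : MvPolynomial (Fin 3) ℝ) : ∃ (N : ℕ) (F : MvPolynomial (Fin 3) ℝ), ∀ a b c : ℝ,
    a ^ (2 * N) * (eval ![a, b, c] Q + eval ![-a, -b, c] Q + eval ![a, b, -c] Q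
      + eval ![-a, -b, -c] Q) = eval ![a ^ 2, b ^ 2 + c ^ 2, a * b] F := by
  induction Q using MvPolynomial.induction_on' with
  | monomial s r =>
    have hm : ∀ a b c : ℝ, eval ![a, b, c] (monomial s r)
        = r * (a ^ (s 0) * b ^ (s 1) * c ^ (s 2)) := by
      intro a b c
      rw [eval_monomial, Finsupp.prod_fintype _ _ (by simp)]
      simp [Fin.prod_univ_three]
    simp only [hm]
    generalize s 0 = i
    generalize s 1 = j
    generalize s 2 = k
    by_cases hk : Even k
    · by_cases hij : Even (i + j)
      · obtain ⟨m, rfl⟩ := hk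
        obtain ⟨e, he⟩ := hij
        refine ⟨j + m, C (4 * r) * X 2 ^ j * (X 0 * X 1 - X 2 ^ 2) ^ m * X 0 ^ e, ?_⟩
        intro a b c
        have h1 : ((-1 : ℝ)) ^ i * (-1) ^ j = 1 := by
          rw [← pow_add, he]; exact Even.neg_one_pow ⟨e, rfl⟩
        have h2 : (-a) ^ i * (-b) ^ j = a ^ i * b ^ j := by
          rw [neg_pow a, neg_pow b]
          linear_combination (a ^ i * b ^ j) * h1
        have h3 : (-c) ^ (m + m) = c ^ (m + m) := Even.neg_pow ⟨m, rfl⟩ c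
        rw [h2, h3]
        have h4 : a ^ 2 * (b ^ 2 + c ^ 2) - (a * b) ^ 2 = (a * c) ^ 2 := by ring
        simp only [map_mul, map_sub, map_pow, eval_C, eval_X, Matrix.cons_val_zero,
          Matrix.cons_val_one, Matrix.cons_val]
        rw [h4]
        have h5 : a ^ i * a ^ j = (a ^ 2) ^ e := by
          rw [← pow_add, he, ← pow_mul]; congr 1; ring
        rw [← h5]
        ring
      · refine ⟨0, 0, ?_⟩
        intro a b c
        have h1 : ((-1 : ℝ)) ^ i * (-1) ^ j = -1 := by
          rw [← pow_add]; exact Odd.neg_one_pow (Nat.not_even_iff_odd.mp hij)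
        have h2 : (-a) ^ i * (-b) ^ j = - (a ^ i * b ^ j) := by
          rw [neg_pow a, neg_pow b]
          linear_combination (a ^ i * b ^ j) * h1
        rw [h2, map_zero]
        ring
    · refine ⟨0, 0, ?_⟩
      intro a b c
      rw [Odd.neg_pow (Nat.not_even_iff_odd.mp hk) c, map_zero]
      ring
  | add p q hp hq =>
    obtain ⟨N, F, hF⟩ := hp
    obtain ⟨M, G, hG⟩ := hq
    refine ⟨N + M, X 0 ^ M * F + X 0 ^ N * G, ?_⟩
    intro a b c
    simp only [map_add, map_mul, map_pow, eval_X, Matrix.cons_val_zero]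
    rw [← hF, ← hG]
    ring

def fU : V3 × V3 → ℝ := fun p => p.1 0 ^ 2 + p.1 1 ^ 2 + p.1 2 ^ 2
def fW : V3 × V3 → ℝ := fun p => p.2 0 ^ 2 + p.2 1 ^ 2 + p.2 2 ^ 2
def fV : V3 × V3 → ℝ := fun p => p.1 0 * p.2 0 + p.1 1 * p.2 1 + p.1 2 * p.2 2

lemma SO3_cols {k : Mat3} (hk : k ∈ SO3) (x y : V3) :
    fU (k.mulVec x, k.mulVec y) = fU (x, y) ∧ fW (k.mulVec x, k.mulVec y) = fW (x, y) ∧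
    fV (k.mulVec x, k.mulVec y) = fV (x, y) := by
  have h : k.transpose * k = 1 := mul_eq_one_comm.mp hk.1
  have key : ∀ x y : V3, (k.mulVec x) ⬝ᵥ (k.mulVec y) = x ⬝ᵥ y := by
    intro x y
    rw [Matrix.dotProduct_mulVec, Matrix.vecMul_mulVec, h, Matrix.vecMul_one]
  have hxx := key x x
  have hyy := key y y
  have hxy := key x y
  simp only [dotProduct, Fin.sum_univ_three] at hxx hyy hxy
  simp only [fU, fV, fW]
  refine ⟨?_, ?_, hxy⟩
  · linear_combination hxx
  · linear_combination hyy

lemma rot_lem (x y : V3) (hD : fU (x, y) * fW (x, y) - fV (x, y) ^ 2 ≠ 0) :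
    ∃ k ∈ SO3, ∃ a b c : ℝ, k.mulVec x = ![a, 0, 0] ∧ k.mulVec y = ![b, c, 0] := by
  have hL : fU (x, y) * fW (x, y) - fV (x, y) ^ 2 = (x 1 * y 2 - x 2 * y 1) ^ 2
      + (x 2 * y 0 - x 0 * y 2) ^ 2 + (x 0 * y 1 - x 1 * y 0) ^ 2 := by
    simp only [fU, fV, fW]; ring
  have hDpos : 0 < fU (x, y) * fW (x, y) - fV (x, y) ^ 2 :=
    lt_of_le_of_ne (by rw [hL]; positivity) hD.symm
  have hW : 0 ≤ fW (x, y) := by simp only [fW]; positivity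
  have hU0 : 0 ≤ fU (x, y) := by simp only [fU]; positivity
  have hU : 0 < fU (x, y) := by
    rcases hU0.lt_or_eq with h | h
    · exact h
    · rw [← h] at hDpos; nlinarith [sq_nonneg (fV (x, y))]
  obtain ⟨R, hR⟩ : ∃ R : ℝ, R ^ 2 * fU (x, y) = 1 :=
    ⟨(√(fU (x, y)))⁻¹, by rw [inv_pow, Real.sq_sqrt hU0]; field_simp⟩
  obtain ⟨S, hS⟩ : ∃ S : ℝ, S ^ 2 * (fU (x, y) * fW (x, y) - fV (x, y) ^ 2) = 1 :=
    ⟨(√(fU (x, y) * fW (x, y) - fV (x, y) ^ 2))⁻¹, by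
      rw [inv_pow, Real.sq_sqrt hDpos.le]; field_simp⟩
  set u := fU (x, y) with hu
  set w := fW (x, y) with hw
  set v := fV (x, y) with hv
  simp only [fU, fV, fW] at hu hv hw
  refine ⟨!![R * x 0, R * x 1, R * x 2;
    R * S * (u * y 0 - v * x 0), R * S * (u * y 1 - v * x 1), R * S * (u * y 2 - v * x 2);
    S * (x 1 * y 2 - x 2 * y 1), S * (x 2 * y 0 - x 0 * y 2), S * (x 0 * y 1 - x 1 * y 0)],
    ⟨?_, ?_⟩, R * u, R * v, R * S * (u * w - v ^ 2), ?_, ?_⟩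
  · have e11 : R * x 0 * (R * x 0) + R * x 1 * (R * x 1) + R * x 2 * (R * x 2) = 1 := by
      linear_combination hR - R ^ 2 * hu
    have e12 : x 0 * (u * y 0 - v * x 0) + x 1 * (u * y 1 - v * x 1) + x 2 * (u * y 2 - v * x 2)
        = 0 := by
      rw [hu, hv]; ring
    have e22 : (u * y 0 - v * x 0) ^ 2 + (u * y 1 - v * x 1) ^ 2 + (u * y 2 - v * x 2) ^ 2
        = u * (u * w - v ^ 2) := by
      rw [hu, hv, hw]; ring
    ext i j
    fin_cases i <;> fin_cases j <;>
      simp [Matrix.mul_apply, Fin.sum_univ_three]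
    · exact e11
    · linear_combination R ^ 2 * S * e12
    · ring
    · linear_combination R ^ 2 * S * e12
    · linear_combination R ^ 2 * S ^ 2 * e22 + hS + S ^ 2 * (u * w - v ^ 2) * hR
    · ring
    · ring
    · ring
    · linear_combination hS - S ^ 2 * hL
  · rw [Matrix.det_fin_three]
    simp
    have : R ^ 2 * S ^ 2 * (u * (u * w - v ^ 2)) = 1 := by
      linear_combination hS + S ^ 2 * (u * w - v ^ 2) * hR
    rw [← this, hu, hv, hw]
    ring
  · ext i
    fin_cases i <;> simp [Matrix.mulVec, dotProduct, Fin.sum_univ_three]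
    · rw [hu]; ring
    · rw [hu, hv]; ring
    · ring
  · ext i
    fin_cases i <;> simp [Matrix.mulVec, dotProduct, Fin.sum_univ_three]
    · rw [hv]; ring
    · rw [hu, hv, hw]; ring
    · ring

lemma diag_mem (e f g : ℝ) (he : e * e = 1) (hf : f * f = 1) (hg : g * g = 1)
    (h : e * f * g = 1) : Matrix.diagonal ![e, f, g] ∈ SO3 := by
  constructor
  · rw [Matrix.diagonal_transpose, Matrix.diagonal_mul_diagonal, ← Matrix.diagonal_one]
    congr 1
    ext i
    fin_cases i <;> simp [he, hf, hg]
  · rw [Matrix.det_diagonal, Fin.prod_univ_three]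
    simpa using h

lemma diag_mulVec (e f g a b c : ℝ) :
    (Matrix.diagonal ![e, f, g]).mulVec ![a, b, c] = ![e * a, f * b, g * c] := by
  ext i
  fin_cases i <;> simp [Matrix.mulVec_diagonal]

def InvP (P : V3 × V3 → ℝ) : Prop :=
  ∀ k ∈ SO3, ∀ x y : V3, P (k.mulVec x, k.mulVec y) = P (x, y)

open MvPolynomial in
lemma loc_lem (P : V3 × V3 → ℝ) (hP : IsPolyFun6 P) (hI : InvP P) :
    ∃ (N : ℕ) (F : MvPolynomial (Fin 3) ℝ), ∀ x y : V3,
      fU (x, y) * fW (x, y) - fV (x, y) ^ 2 ≠ 0 →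
      fU (x, y) ^ N * P (x, y) = eval ![fU (x, y), fW (x, y), fV (x, y)] F := by
  obtain ⟨Q, hQ⟩ := hP
  let q : MvPolynomial (Fin 3) ℝ := bind₁ ![X 0, 0, 0, X 1, X 2, 0] Q
  have hq : ∀ a b c : ℝ, eval ![a, b, c] q = P (![a, 0, 0], ![b, c, 0]) := by
    intro a b c
    rw [hQ]
    simp only [q]
    change eval₂Hom (RingHom.id ℝ) _ (bind₁ _ Q) = _
    rw [eval₂Hom_bind₁]
    change eval₂Hom (RingHom.id ℝ) _ Q = eval₂Hom (RingHom.id ℝ) _ Q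
    congr 2
    ext i
    fin_cases i <;> simp
  obtain ⟨N, F, hF⟩ := avg_lem q
  refine ⟨N, C (1 / 4) * F, ?_⟩
  intro x y hD
  obtain ⟨k, hk, a, b, c, hx, hy⟩ := rot_lem x y hD
  obtain ⟨h1, h2, h3⟩ := SO3_cols hk x y
  rw [← h1, ← h2, ← h3, ← hI k hk x y, hx, hy]
  have g1 := hI _ (diag_mem (-1) (-1) 1 (by norm_num) (by norm_num) (by norm_num) (by norm_num))
    ![a, 0, 0] ![b, c, 0]
  have g2 := hI _ (diag_mem (-1) 1 (-1) (by norm_num) (by norm_num) (by norm_num) (by norm_num))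
    ![a, 0, 0] ![b, c, 0]
  have g3 := hI _ (diag_mem 1 (-1) (-1) (by norm_num) (by norm_num) (by norm_num) (by norm_num))
    ![a, 0, 0] ![b, c, 0]
  simp only [diag_mulVec, mul_zero, one_mul, neg_one_mul, neg_zero] at g1 g2 g3
  have h := hF a b c
  simp only [hq, g1, g2, g3] at h
  have eU : fU (![a, 0, 0], ![b, c, 0]) = a ^ 2 := by simp [fU]
  have eW : fW (![a, 0, 0], ![b, c, 0]) = b ^ 2 + c ^ 2 := by simp [fW]
  have eV : fV (![a, 0, 0], ![b, c, 0]) = a * b := by simp [fV]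
  rw [eU, eW, eV, map_mul, ← h, eval_C, ← pow_mul]
  ring

open MvPolynomial in
lemma poly_add {f g : V3 × V3 → ℝ} (hf : IsPolyFun6 f) (hg : IsPolyFun6 g) :
    IsPolyFun6 (f + g) := by
  obtain ⟨F, hF⟩ := hf
  obtain ⟨G, hG⟩ := hg
  exact ⟨F + G, fun p => by rw [Pi.add_apply, hF, hG, map_add]⟩

open MvPolynomial in
lemma poly_mul {f g : V3 × V3 → ℝ} (hf : IsPolyFun6 f) (hg : IsPolyFun6 g) :
    IsPolyFun6 (f * g) := by
  obtain ⟨F, hF⟩ := hf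
  obtain ⟨G, hG⟩ := hg
  exact ⟨F * G, fun p => by rw [Pi.mul_apply, hF, hG, map_mul]⟩

open MvPolynomial in
lemma poly_U : IsPolyFun6 fU := ⟨X 0 ^ 2 + X 1 ^ 2 + X 2 ^ 2, fun p => by simp [fU]⟩
open MvPolynomial in
lemma poly_W : IsPolyFun6 fW := ⟨X 3 ^ 2 + X 4 ^ 2 + X 5 ^ 2, fun p => by simp [fW]⟩
open MvPolynomial in
lemma poly_V : IsPolyFun6 fV := ⟨X 0 * X 3 + X 1 * X 4 + X 2 * X 5, fun p => by simp [fV]⟩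

lemma adj_sub (P : V3 × V3 → ℝ) (hP : P ∈ Algebra.adjoin ℝ ({fU, fW, fV} : Set (V3 × V3 → ℝ))) :
    IsPolyFun6 P ∧ InvP P := by
  induction hP using Algebra.adjoin_induction with
  | mem f hf =>
    rcases hf with rfl | rfl | rfl
    · exact ⟨poly_U, fun k hk x y => (SO3_cols hk x y).1⟩
    · exact ⟨poly_W, fun k hk x y => (SO3_cols hk x y).2.1⟩
    · exact ⟨poly_V, fun k hk x y => (SO3_cols hk x y).2.2⟩
  | algebraMap r =>
    exact ⟨⟨MvPolynomial.C r, fun p => by simp⟩, fun k hk x y => rfl⟩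
  | add f g _ _ hf hg =>
    exact ⟨poly_add hf.1 hg.1, fun k hk x y => by
      simp only [Pi.add_apply]; rw [hf.2 k hk, hg.2 k hk]⟩
  | mul f g _ _ hf hg =>
    exact ⟨poly_mul hf.1 hg.1, fun k hk x y => by
      simp only [Pi.mul_apply]; rw [hf.2 k hk, hg.2 k hk]⟩

open MvPolynomial in
lemma eval_mem (H : MvPolynomial (Fin 3) ℝ) :
    (fun p => eval ![fU p, fW p, fV p] H) ∈
      Algebra.adjoin ℝ ({fU, fW, fV} : Set (V3 × V3 → ℝ)) := by
  induction H using MvPolynomial.induction_on with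
  | C r =>
    simp only [eval_C]
    exact Subalgebra.algebraMap_mem (Algebra.adjoin ℝ ({fU, fW, fV} : Set (V3 × V3 → ℝ))) r
  | add p q hp hq =>
    simp only [map_add]
    exact add_mem hp hq
  | mul_X p i hp =>
    have : (fun p => ![fU p, fW p, fV p] i) ∈
      Algebra.adjoin ℝ ({fU, fW, fV} : Set (V3 × V3 → ℝ)) := by
      fin_cases i <;> apply Algebra.subset_adjoin <;> simp
    simp only [map_mul, eval_X]
    exact mul_mem hp this

open MvPolynomial in
lemma vanish (R : MvPolynomial (Fin 3) ℝ) (h : ∀ x y : V3,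
      fU (x, y) * fW (x, y) - fV (x, y) ^ 2 ≠ 0 →
      eval ![fU (x, y), fW (x, y), fV (x, y)] R = 0) : R = 0 := by
  apply MvPolynomial.funext_set ![Set.Ioo (1 : ℝ) 2, Set.Ioo (1 : ℝ) 2, Set.Ioo (0 : ℝ) 1]
  · intro i
    fin_cases i <;> simp <;> exact Set.Ioo_infinite (by norm_num)
  · intro z hz
    have h0 : z 0 ∈ Set.Ioo (1 : ℝ) 2 := hz 0 trivial
    have h1 : z 1 ∈ Set.Ioo (1 : ℝ) 2 := hz 1 trivial
    have h2 : z 2 ∈ Set.Ioo (0 : ℝ) 1 := hz 2 trivial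
    obtain ⟨u1, u2⟩ := h0
    obtain ⟨w1, w2⟩ := h1
    obtain ⟨v1, v2⟩ := h2
    have hpos : 0 < z 0 * z 1 - z 2 ^ 2 := by nlinarith
    have hu : 0 < z 0 := by linarith
    have ha : √(z 0) ^ 2 = z 0 := Real.sq_sqrt hu.le
    have ha0 : √(z 0) ≠ 0 := (Real.sqrt_pos.mpr hu).ne'
    have hc : √((z 0 * z 1 - z 2 ^ 2) / z 0) ^ 2 = (z 0 * z 1 - z 2 ^ 2) / z 0 :=
      Real.sq_sqrt (by positivity)
    have key := h ![√(z 0), 0, 0] ![z 2 / √(z 0), √((z 0 * z 1 - z 2 ^ 2) / z 0), 0]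
    have eU : fU (![√(z 0), 0, 0], ![z 2 / √(z 0), √((z 0 * z 1 - z 2 ^ 2) / z 0), 0]) = z 0 := by
      simp only [fU]; simpa using ha
    have eW : fW (![√(z 0), 0, 0], ![z 2 / √(z 0), √((z 0 * z 1 - z 2 ^ 2) / z 0), 0]) = z 1 := by
      simp only [fW, Matrix.cons_val_zero, Matrix.cons_val_one, Matrix.cons_val]
      rw [hc, div_pow, ha]; field_simp; ring
    have eV : fV (![√(z 0), 0, 0], ![z 2 / √(z 0), √((z 0 * z 1 - z 2 ^ 2) / z 0), 0]) = z 2 := by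
      simp only [fV, Matrix.cons_val_zero, Matrix.cons_val_one, Matrix.cons_val]
      field_simp; ring
    rw [eU, eV, eW] at key
    have hz' : ![z 0, z 1, z 2] = z := by
      ext i; fin_cases i <;> rfl
    rw [hz'] at key
    rw [map_zero]
    exact key hpos.ne'

open MvPolynomial in
lemma main_lem (P : V3 × V3 → ℝ) (hP : IsPolyFun6 P) (hI : InvP P) :
    ∃ H : MvPolynomial (Fin 3) ℝ, P = fun p => eval ![fU p, fW p, fV p] H := by
  obtain ⟨N, F, hF⟩ := loc_lem P hP hI
  obtain ⟨M, G, hG⟩ := loc_lem (fun p => P (p.2, p.1)) (by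
    obtain ⟨Q, hQ⟩ := hP
    refine ⟨rename ![3, 4, 5, 0, 1, 2] Q, fun p => ?_⟩
    rw [eval_rename]
    change P (p.2, p.1) = _
    rw [hQ]
    congr 2
    ext i
    fin_cases i <;> rfl) (fun k hk x y => hI k hk y x)
  have sU : ∀ x y, fU (y, x) = fW (x, y) := fun x y => rfl
  have sW : ∀ x y, fW (y, x) = fU (x, y) := fun x y => rfl
  have sV : ∀ x y, fV (y, x) = fV (x, y) := fun x y => by simp only [fV]; ring
  let G' : MvPolynomial (Fin 3) ℝ := rename ![1, 0, 2] G
  have hG' : ∀ x y : V3, fU (x, y) * fW (x, y) - fV (x, y) ^ 2 ≠ 0 →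
      fW (x, y) ^ M * P (x, y) = eval ![fU (x, y), fW (x, y), fV (x, y)] G' := by
    intro x y h
    have := hG y x (by rw [sU x y, sW x y, sV x y, mul_comm]; exact h)
    rw [sU x y, sW x y, sV x y] at this
    simp only at this
    rw [this, eval_rename]
    congr 2
    ext i
    fin_cases i <;> rfl
  have e : X 1 ^ M * F = X 0 ^ N * G' := by
    rw [← sub_eq_zero]
    apply vanish
    intro x y h
    simp only [map_sub, map_mul, map_pow, eval_X, Matrix.cons_val_zero, Matrix.cons_val_one]
    rw [← hF x y h, ← hG' x y h]
    ring
  have hpr : Prime (X 0 : MvPolynomial (Fin 3) ℝ) := X_prime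
  have hdvd : (X 0 : MvPolynomial (Fin 3) ℝ) ^ N ∣ F := by
    apply hpr.pow_dvd_of_dvd_mul_left (a := X 1 ^ M) N
    · intro h
      have := hpr.dvd_of_dvd_pow h
      rw [X_dvd_X] at this
      simp at this
    · exact ⟨G', e⟩
  obtain ⟨H, rfl⟩ := hdvd
  refine ⟨H, ?_⟩
  obtain ⟨A, hA⟩ := (adj_sub _ (eval_mem H)).1
  obtain ⟨Q, hQ⟩ := hP
  obtain ⟨D, hD⟩ : IsPolyFun6 (fun p => fU p * fW p - fV p ^ 2) := by
    obtain ⟨a, ha⟩ := poly_U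
    obtain ⟨b, hb⟩ := poly_W
    obtain ⟨c, hc⟩ := poly_V
    exact ⟨a * b - c ^ 2, fun p => by simp only [map_sub, map_mul, map_pow, ← ha, ← hb, ← hc]⟩
  have hz : D * (Q - A) = 0 := by
    apply MvPolynomial.funext
    intro z
    have e1 := hD (![z 0, z 1, z 2], ![z 3, z 4, z 5])
    have e2 := hQ (![z 0, z 1, z 2], ![z 3, z 4, z 5])
    have e3 := hA (![z 0, z 1, z 2], ![z 3, z 4, z 5])
    have hz' : ![(![z 0, z 1, z 2] : V3) 0, (![z 0, z 1, z 2] : V3) 1, (![z 0, z 1, z 2] : V3) 2,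
      (![z 3, z 4, z 5] : V3) 0, (![z 3, z 4, z 5] : V3) 1, (![z 3, z 4, z 5] : V3) 2] = z := by
      ext i; fin_cases i <;> rfl
    simp only [hz'] at e1 e2 e3
    rw [map_mul, map_sub, ← e1, ← e2, ← e3, map_zero, mul_eq_zero]
    by_cases h0 : fU (![z 0, z 1, z 2], ![z 3, z 4, z 5]) * fW (![z 0, z 1, z 2], ![z 3, z 4, z 5])
      - fV (![z 0, z 1, z 2], ![z 3, z 4, z 5]) ^ 2 = 0
    · exact Or.inl h0
    · right
      have := hF _ _ h0
      simp only [map_mul, map_pow, eval_X, Matrix.cons_val_zero] at this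
      have hne : fU (![z 0, z 1, z 2], ![z 3, z 4, z 5]) ≠ 0 := by
        intro hU
        apply h0
        have a0 : z 0 = 0 := by
          simp [fU] at hU; nlinarith [sq_nonneg (z 0), sq_nonneg (z 1), sq_nonneg (z 2)]
        have a1 : z 1 = 0 := by
          simp [fU] at hU; nlinarith [sq_nonneg (z 0), sq_nonneg (z 1), sq_nonneg (z 2)]
        have a2 : z 2 = 0 := by
          simp [fU] at hU; nlinarith [sq_nonneg (z 0), sq_nonneg (z 1), sq_nonneg (z 2)]
        simp [fU, fV, a0, a1, a2]
      exact sub_eq_zero.mpr (mul_left_cancel₀ (pow_ne_zero N hne) this)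
  have hD0 : D ≠ 0 := by
    intro h
    have := hD (![1, 0, 0], ![0, 1, 0])
    rw [h] at this
    simp [fU, fV, fW] at this
  have hQA : Q = A := sub_eq_zero.mp ((mul_eq_zero.mp hz).resolve_left hD0)
  funext p
  rw [hQ, hQA, ← hA]

/-- The polynomials `|x|²`, `|y|²`, `x·y` generate the algebra of `SO(3)`-invariant
polynomial functions on `ℝ³ × ℝ³`. -/
theorem statement11 :
    {P : V3 × V3 → ℝ | IsPolyFun6 P ∧
        ∀ k ∈ SO3, ∀ x y : V3, P (k.mulVec x, k.mulVec y) = P (x, y)}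
      = ↑(Algebra.adjoin ℝ
          ({fun p => p.1 0 ^ 2 + p.1 1 ^ 2 + p.1 2 ^ 2,
            fun p => p.2 0 ^ 2 + p.2 1 ^ 2 + p.2 2 ^ 2,
            fun p => p.1 0 * p.2 0 + p.1 1 * p.2 1 + p.1 2 * p.2 2} :
            Set (V3 × V3 → ℝ))) := by
  ext P
  constructor
  · rintro ⟨hP, hI⟩
    obtain ⟨H, rfl⟩ := main_lem P hP hI
    exact eval_mem H
  · intro h
    exact adj_sub P h
end
end
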